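/- arXiv:0803.0552 — 3 statements merged into one kernel-verified Lean document; each statement's English description precedes it below -/
import Mathlib

section
/- Let μ > 1 and let g ∈ Ĉ_2(B) be such that ‖δ̂g‖_μ < ∞. Then there exists F ∈ Ĉ_2(B) with δ̂F = 0 and ‖F − g‖_μ ≤ c ‖δ̂g‖_μ (c depending only on μ and on the semigroup bound M) such that for every (t,s) ∈ 𝒮_2 with s < t, F_{ts} is the limit of the semigroup-weighted Riemann sums Σ_{i=0}^{n−1} S_{t − t_{i+1}} g_{t_{i+1} t_i} taken over partitions s = t_0 < t_1 < ⋯ < t_n = t of [s,t] as the mesh tends to zero. -/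
open scoped BigOperators

universe u

/-- A strongly continuous semigroup of bounded operators on `B`,
uniformly bounded in operator norm by `M`. -/
def IsSG {B : Type u} [NormedAddCommGroup B] [NormedSpace ℝ B]
    (S : ℝ → B →L[ℝ] B) (M : ℝ) : Prop :=
  S 0 = ContinuousLinearMap.id ℝ B ∧
  (∀ s t : ℝ, 0 ≤ s → 0 ≤ t → S (t + s) = (S t).comp (S s)) ∧
  (∀ x : B, ContinuousOn (fun t => S t x) (Set.Ici 0)) ∧
  ∀ t : ℝ, 0 ≤ t → ‖S t‖ ≤ M

/-- A decomposition `h = Σᵢ hᵢ` on the simplex with `hᵢ ∈ Ĉ₃(B)` and mixed Hölder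
bounds `‖hᵢ(t,u,s)‖ ≤ Kᵢ (t−u)^{ρᵢ} (u−s)^{μ−ρᵢ}`, `ρᵢ ∈ (0,μ)`: a witness
that `‖h‖_μ ≤ Σᵢ Kᵢ`. -/
def HatDecomp {B : Type u} [NormedAddCommGroup B] (T μ : ℝ)
    (h : ℝ → ℝ → ℝ → B) (n : ℕ) (hs : Fin n → ℝ → ℝ → ℝ → B) (ρ K : Fin n → ℝ) : Prop :=
  (∀ i, ρ i ∈ Set.Ioo 0 μ) ∧ (∀ i, 0 ≤ K i) ∧
  (∀ i, ContinuousOn (fun q : ℝ × ℝ × ℝ => hs i q.1 q.2.1 q.2.2)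
    {q : ℝ × ℝ × ℝ | 0 ≤ q.2.2 ∧ q.2.2 ≤ q.2.1 ∧ q.2.1 ≤ q.1 ∧ q.1 ≤ T}) ∧
  (∀ t u s : ℝ, 0 ≤ s → s ≤ u → u ≤ t → t ≤ T → h t u s = ∑ i, hs i t u s) ∧
  ∀ i, ∀ t u s : ℝ, 0 ≤ s → s ≤ u → u ≤ t → t ≤ T →
    ‖hs i t u s‖ ≤ K i * (t - u) ^ ρ i * (u - s) ^ (μ - ρ i)

namespace Sew

lemma rpow_sum_le (p d : ℝ) (hp : 1 < p) (n : ℕ) (x : ℕ → ℝ)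
    (h0 : ∀ i < n, x i ≤ x (i + 1)) (h1 : ∀ i < n, x (i + 1) - x i ≤ d) :
    ∑ i ∈ Finset.range n, (x (i + 1) - x i) ^ p ≤ d ^ (p - 1) * (x n - x 0) := by
  rw [← Finset.sum_range_sub, Finset.mul_sum]
  apply Finset.sum_le_sum
  intro i hi
  have hi := Finset.mem_range.1 hi
  have a0 : 0 ≤ x (i + 1) - x i := by linarith [h0 i hi]
  have e : (x (i + 1) - x i) ^ p = (x (i + 1) - x i) ^ (p - 1) * (x (i + 1) - x i) := by
    rw [← Real.rpow_add_one' a0 (by linarith)]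
    congr 1
    ring
  rw [e]
  apply mul_le_mul_of_nonneg_right _ a0
  exact Real.rpow_le_rpow a0 (h1 i hi) (by linarith)

lemma decomp_bound {B : Type u} [NormedAddCommGroup B] (T μ : ℝ) (hμ : 1 < μ)
    (h : ℝ → ℝ → ℝ → B) (n : ℕ) (hs : Fin n → ℝ → ℝ → ℝ → B) (ρ K : Fin n → ℝ)
    (H : HatDecomp T μ h n hs ρ K) :
    ∀ t u s : ℝ, 0 ≤ s → s ≤ u → u ≤ t → t ≤ T → ‖h t u s‖ ≤ (∑ i, K i) * (t - s) ^ μ := by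
  obtain ⟨hρ, hK, -, he, hb⟩ := H
  intro t u s h0 h1 h2 h3
  rw [he t u s h0 h1 h2 h3, Finset.sum_mul]
  refine (norm_sum_le _ _).trans (Finset.sum_le_sum fun i _ => ?_)
  refine (hb i t u s h0 h1 h2 h3).trans ?_
  have r := hρ i
  rw [mul_assoc]
  apply mul_le_mul_of_nonneg_left _ (hK i)
  have e : (t - s) ^ μ = (t - s) ^ (ρ i) * (t - s) ^ (μ - ρ i) := by
    rw [← Real.rpow_add' (by linarith) (by linarith)]
    congr 1
    ring
  rw [e]
  have := r.1
  have := r.2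
  apply mul_le_mul
  · exact Real.rpow_le_rpow (by linarith) (by linarith) (by linarith)
  · exact Real.rpow_le_rpow (by linarith) (by linarith) (by linarith)
  · exact Real.rpow_nonneg (by linarith) _
  · exact Real.rpow_nonneg (by linarith) _

/-- Properties of the two-parameter function needed for sewing. -/
structure Good {B : Type u} [NormedAddCommGroup B] [NormedSpace ℝ B]
    (S : ℝ → B →L[ℝ] B) (M T μ K : ℝ) (g : ℝ → ℝ → B) : Prop where
  sg : IsSG S M
  hμ : 1 < μ
  hM : 1 ≤ M
  hK : 0 ≤ K
  hd : ∀ t u s : ℝ, 0 ≤ s → s ≤ u → u ≤ t → t ≤ T →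
    ‖g t s - g t u - S (t - u) (g u s)‖ ≤ K * (t - s) ^ μ

variable {B : Type u} [NormedAddCommGroup B] [NormedSpace ℝ B]
    {S : ℝ → B →L[ℝ] B} {M T μ K : ℝ} {g : ℝ → ℝ → B}

lemma IsSG.norm_le (h : IsSG S M) {t : ℝ} (ht : 0 ≤ t) (x : B) : ‖S t x‖ ≤ M * ‖x‖ :=
  ContinuousLinearMap.le_of_opNorm_le _ (h.2.2.2 t ht) x

lemma IsSG.comp (h : IsSG S M) {s t r : ℝ} (hs : 0 ≤ s) (ht : 0 ≤ t) (e : t + s = r) (x : B) :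
    S t (S s x) = S r x := by
  rw [← e, h.2.1 s t hs ht]; rfl

lemma IsSG.zero (h : IsSG S M) (x : B) : S 0 x = x := by rw [h.1]; rfl

lemma Good.diag (G : Good S M T μ K g) (t : ℝ) (h0 : 0 ≤ t) (h1 : t ≤ T) : g t t = 0 := by
  have := G.hd t t t h0 le_rfl le_rfl h1
  have hμ := G.hμ
  rw [sub_self, sub_self, G.sg.1, Real.zero_rpow (by linarith)] at this
  simpa using this

lemma theta (hμ : 1 < μ) : 0 < 1 - 2 * (1 / 2 : ℝ) ^ μ := by
  have : (1 / 2 : ℝ) ^ μ < (1 / 2 : ℝ) ^ (1 : ℝ) :=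
    Real.rpow_lt_rpow_of_exponent_gt (by norm_num) (by norm_num) hμ
  rw [Real.rpow_one] at this
  linarith

noncomputable def cst (M μ : ℝ) : ℝ := 2 * M / (1 - 2 * (1 / 2 : ℝ) ^ μ)

lemma cst_pos (hμ : 1 < μ) (hM : 1 ≤ M) : 0 < cst M μ :=
  div_pos (by linarith) (theta hμ)

lemma cst_eq (hμ : 1 < μ) : cst M μ * (2 * (1 / 2 : ℝ) ^ μ) + 2 * M = cst M μ := by
  have := theta hμ
  unfold cst
  field_simp
  ring

lemma exists_mid (x : ℕ → ℝ) (m : ℝ) (a d : ℕ) (h1 : x a ≤ m) (h2 : m ≤ x (a + d + 1)) :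
    ∃ k, a ≤ k ∧ k < a + d + 1 ∧ x k ≤ m ∧ m ≤ x (k + 1) := by
  induction d with
  | zero => exact ⟨a, le_rfl, by omega, h1, h2⟩
  | succ d ih =>
    rcases le_total m (x (a + d + 1)) with h | h
    · obtain ⟨k, p, q, r⟩ := ih h
      exact ⟨k, p, by omega, r⟩
    · exact ⟨a + d + 1, by omega, by omega, h, h2⟩

lemma sum_split (sg : IsSG S M) (x : ℕ → ℝ) (hx : Monotone x) (a k b : ℕ) (h1 : a ≤ k)
    (h2 : k ≤ b) :
    ∑ i ∈ Finset.Ico a b, S (x b - x (i + 1)) (g (x (i + 1)) (x i)) =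
    S (x b - x k) (∑ i ∈ Finset.Ico a k, S (x k - x (i + 1)) (g (x (i + 1)) (x i)))
    + ∑ i ∈ Finset.Ico k b, S (x b - x (i + 1)) (g (x (i + 1)) (x i)) := by
  rw [← Finset.sum_Ico_consecutive _ h1 h2, map_sum]
  congr 1
  apply Finset.sum_congr rfl
  intro i hi
  have hi := (Finset.mem_Ico.1 hi).2
  have := hx (show i + 1 ≤ k from hi)
  have := hx h2
  rw [IsSG.comp sg (by linarith) (by linarith) (r := x b - x (i + 1)) (by ring)]

lemma Good.claim (G : Good S M T μ K g) (x : ℕ → ℝ) (hx : Monotone x) (h0 : ∀ i, 0 ≤ x i)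
    (hT : ∀ i, x i ≤ T) (N : ℕ) : ∀ a b : ℕ, a ≤ b → b - a ≤ N → ∀ r : ℝ, 0 ≤ r →
    ‖S r ((∑ i ∈ Finset.Ico a b, S (x b - x (i + 1)) (g (x (i + 1)) (x i))) - g (x b) (x a))‖
      ≤ cst M μ * K * (x b - x a) ^ μ := by
  have sg := G.sg
  have hμ := G.hμ
  have hM := G.hM
  have hK := G.hK
  have hc := cst_pos hμ hM
  induction N with
  | zero =>
    intro a b hab hN r hr
    obtain rfl : a = b := by omega
    rw [G.diag _ (h0 a) (hT a)]
    simp only [Finset.Ico_self, Finset.sum_empty, sub_self, map_zero, norm_zero]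
    rw [Real.zero_rpow (by linarith)]
    simp
  | succ N ih =>
    intro a b hab hN r hr
    rcases Nat.lt_or_ge (b - a) (N + 1) with h | h
    · exact ih a b hab (by omega) r hr
    obtain ⟨d, rfl⟩ : ∃ d, b = a + d + 1 := ⟨b - a - 1, by omega⟩
    set b := a + d + 1 with hb
    have hxab := hx hab
    obtain ⟨k, hak, hkb, hk1, hk2⟩ := exists_mid x ((x a + x b) / 2) a d (by linarith)
      (by rw [← hb]; linarith)
    have hkb : k + 1 ≤ b := hkb
    have i1 := hx hak
    have i2 := hx hkb
    have i3 := hx (Nat.le_succ k)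
    have e1 := sum_split (g := g) sg x hx a k b hak (by omega)
    have e2 := sum_split (g := g) sg x hx k (k + 1) b (by omega) hkb
    rw [Nat.Ico_succ_singleton, Finset.sum_singleton, sub_self, IsSG.zero sg] at e2
    rw [e2] at e1
    have A := ih a k hak (by omega) (r + (x b - x k)) (by linarith [i3, i2])
    have C := ih (k + 1) b hkb (by omega) r hr
    have D1 := G.hd (x b) (x k) (x a) (h0 a) i1 (i3.trans i2) (hT b)
    have D2 := G.hd (x b) (x (k + 1)) (x k) (h0 k) i3 i2 (hT b)
    rw [← IsSG.comp sg (s := x b - x k) (t := r) (by linarith [i3, i2]) hr rfl] at A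
    set X := ∑ i ∈ Finset.Ico a k, S (x k - x (i + 1)) (g (x (i + 1)) (x i))
    set Y := ∑ i ∈ Finset.Ico (k + 1) b, S (x b - x (i + 1)) (g (x (i + 1)) (x i))
    have key : (∑ i ∈ Finset.Ico a b, S (x b - x (i + 1)) (g (x (i + 1)) (x i))) - g (x b) (x a)
        = S (x b - x k) (X - g (x k) (x a)) + (Y - g (x b) (x (k + 1)))
          - (g (x b) (x a) - g (x b) (x k) - S (x b - x k) (g (x k) (x a)))
          - (g (x b) (x k) - g (x b) (x (k + 1))
            - S (x b - x (k + 1)) (g (x (k + 1)) (x k))) := by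
      rw [e1, map_sub]
      abel
    rw [key, map_sub, map_sub, map_add]
    have D1' := (IsSG.norm_le sg hr _).trans (mul_le_mul_of_nonneg_left D1 (by linarith : 0 ≤ M))
    have D2' := (IsSG.norm_le sg hr _).trans (mul_le_mul_of_nonneg_left D2 (by linarith : 0 ≤ M))
    have half : ∀ z : ℝ, 0 ≤ z → z ≤ (x b - x a) * (1 / 2) →
        z ^ μ ≤ (x b - x a) ^ μ * (1 / 2 : ℝ) ^ μ := by
      intro z hz hz'
      rw [← Real.mul_rpow (by linarith) (by norm_num)]
      exact Real.rpow_le_rpow hz hz' (by linarith)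
    have p1 := half (x k - x a) (by linarith) (by linarith)
    have p2 := half (x b - x (k + 1)) (by linarith) (by linarith)
    have p3 : (x b - x k) ^ μ ≤ (x b - x a) ^ μ :=
      Real.rpow_le_rpow (by linarith) (by linarith) (by linarith)
    have cK : 0 ≤ cst M μ * K := by positivity
    have MK : 0 ≤ M * K := by positivity
    have q1 := mul_le_mul_of_nonneg_left p1 cK
    have q2 := mul_le_mul_of_nonneg_left p2 cK
    have q3 := mul_le_mul_of_nonneg_left p3 MK
    have ce := cst_eq (M := M) hμ
    refine (norm_sub_le _ _).trans ((add_le_add_left (norm_sub_le _ _) _).trans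
      ((add_le_add_left (add_le_add_left (norm_add_le _ _) _) _).trans ?_))
    have fin : cst M μ * K * (x b - x a) ^ μ =
      (cst M μ * (2 * (1 / 2 : ℝ) ^ μ) + 2 * M) * K * (x b - x a) ^ μ := by rw [ce]
    rw [fin]
    nlinarith [A, C, D1', D2', q1, q2, q3]

noncomputable def cl (s t x : ℝ) : ℝ := max s (min t x)

lemma cl_mono (s t : ℝ) : Monotone (cl s t) := fun _ _ h =>
  max_le_max le_rfl (min_le_min le_rfl h)

lemma le_cl (s t x : ℝ) : s ≤ cl s t x := le_max_left _ _
lemma cl_le {s t : ℝ} (h : s ≤ t) (x : ℝ) : cl s t x ≤ t := max_le h (min_le_left _ _)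

lemma cl_sub (s t x y : ℝ) (h : x ≤ y) : cl s t y - cl s t x ≤ y - x := by
  unfold cl; grind

lemma cl_bot {s t x : ℝ} (h : s ≤ t) (hx : x ≤ s) : cl s t x = s := by
  unfold cl; grind

lemma cl_top {s t x : ℝ} (h : s ≤ t) (hx : t ≤ x) : cl s t x = t := by
  unfold cl; grind

/-- Riemann sums along the clamped dyadic grid. -/
noncomputable def gr (T : ℝ) (n i : ℕ) : ℝ := i * (T / 2 ^ n)

lemma gr_mono (hT : 0 < T) (n : ℕ) : Monotone (gr T n) := fun i j h => by
  unfold gr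
  have : (i : ℝ) ≤ j := by exact_mod_cast h
  gcongr

lemma gr_zero (n : ℕ) : gr T n 0 = 0 := by simp [gr]
lemma gr_last (n : ℕ) : gr T n (2 ^ n) = T := by simp [gr]; field_simp
lemma gr_succ (n i : ℕ) : gr T n (i + 1) - gr T n i = T / 2 ^ n := by simp [gr]; ring
lemma gr_two (n i : ℕ) : gr T (n + 1) (2 * i) = gr T n i := by simp [gr, pow_succ]; field_simp

noncomputable def R (S : ℝ → B →L[ℝ] B) (g : ℝ → ℝ → B) (T : ℝ) (n : ℕ) (t s : ℝ) : B :=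
  ∑ i ∈ Finset.range (2 ^ n), S (t - cl s t (gr T n (i + 1)))
    (g (cl s t (gr T n (i + 1))) (cl s t (gr T n i)))

lemma cl_sum (hμ : 1 < μ) (hT : 0 < T) (n : ℕ) (t s : ℝ) (h0 : 0 ≤ s) (h1 : s ≤ t) (h2 : t ≤ T) :
    ∑ i ∈ Finset.range (2 ^ n), (cl s t (gr T n (i + 1)) - cl s t (gr T n i)) ^ μ ≤
      T ^ μ * ((1 / 2 : ℝ) ^ (μ - 1)) ^ n := by
  refine (rpow_sum_le μ (T / 2 ^ n) hμ (2 ^ n) (fun i => cl s t (gr T n i)) ?_ ?_).trans ?_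
  · intro i _
    exact cl_mono s t (gr_mono hT n (Nat.le_succ i))
  · intro i _
    exact (cl_sub _ _ _ _ (gr_mono hT n (Nat.le_succ i))).trans (gr_succ n i).le
  · have e : T / 2 ^ n = T * (1 / 2 : ℝ) ^ n := by simp; field_simp
    rw [gr_zero, gr_last, cl_bot h1 h0, cl_top h1 h2, e, Real.mul_rpow hT.le (by positivity)]
    have e2 : ((1 / 2 : ℝ) ^ n) ^ (μ - 1) = ((1 / 2 : ℝ) ^ (μ - 1)) ^ n := by
      rw [← Real.rpow_natCast, ← Real.rpow_natCast, ← Real.rpow_mul (by norm_num),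
        ← Real.rpow_mul (by norm_num), mul_comm]
    have e3 : T ^ μ = T ^ (μ - 1) * T := by
      rw [← Real.rpow_add_one hT.ne']; congr 1; ring
    rw [e2, e3]
    have : t - s ≤ T := by linarith
    have hp : 0 ≤ T ^ (μ - 1) * ((1 / 2 : ℝ) ^ (μ - 1)) ^ n := by positivity
    nlinarith

lemma sum_two (f : ℕ → B) (n : ℕ) :
    ∑ i ∈ Finset.range (2 * n), f i = ∑ i ∈ Finset.range n, (f (2 * i) + f (2 * i + 1)) := by
  induction n with
  | zero => simp
  | succ n ih =>
    rw [Finset.sum_range_succ, ← ih, Nat.mul_succ, Finset.sum_range_succ, Finset.sum_range_succ]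
    abel

lemma Good.step (G : Good S M T μ K g) (hT : 0 < T) (n : ℕ) (t s : ℝ) (h0 : 0 ≤ s) (h1 : s ≤ t)
    (h2 : t ≤ T) :
    dist (R S g T n t s) (R S g T (n + 1) t s) ≤
      (M * K * T ^ μ) * ((1 / 2 : ℝ) ^ (μ - 1)) ^ n := by
  have hM := G.hM
  have hK := G.hK
  have sg := G.sg
  have MK : 0 ≤ M * K := mul_nonneg (by linarith) hK
  rw [mul_assoc]
  refine le_trans ?_ (mul_le_mul_of_nonneg_left (cl_sum G.hμ hT n t s h0 h1 h2) MK)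
  unfold R
  rw [dist_eq_norm, pow_succ, mul_comm (2 ^ n) 2, sum_two, ← Finset.sum_sub_distrib, Finset.mul_sum]
  refine (norm_sum_le _ _).trans (Finset.sum_le_sum fun i _ => ?_)
  have e : 2 * i + 1 + 1 = 2 * (i + 1) := by ring
  rw [e, gr_two, gr_two]
  have m1 : gr T n i ≤ gr T (n + 1) (2 * i + 1) := by
    rw [← gr_two n i]; exact gr_mono hT _ (by omega)
  have m2 : gr T (n + 1) (2 * i + 1) ≤ gr T n (i + 1) := by
    rw [← gr_two n (i + 1)]; exact gr_mono hT _ (by omega)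
  have m1 := cl_mono s t m1
  have m2 := cl_mono s t m2
  have l1 := le_cl s t (gr T n i)
  have l2 := cl_le h1 (gr T n (i + 1))
  set a := cl s t (gr T n i)
  set m := cl s t (gr T (n + 1) (2 * i + 1))
  set b := cl s t (gr T n (i + 1))
  have d := G.hd b m a (h0.trans l1) m1 m2 (l2.trans h2)
  have : S (t - b) (g b a) - (S (t - m) (g m a) + S (t - b) (g b m)) =
      S (t - b) (g b a - g b m - S (b - m) (g m a)) := by
    rw [map_sub, map_sub, IsSG.comp sg (s := b - m) (t := t - b) (r := t - m) (by linarith)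
      (by linarith) (by ring)]
    abel
  rw [this, mul_assoc]
  exact (IsSG.norm_le sg (by linarith) _).trans (mul_le_mul_of_nonneg_left d (by linarith))

lemma Good.add (G : Good S M T μ K g) (hT : 0 < T) (n : ℕ) (t u s : ℝ) (h0 : 0 ≤ s) (h1 : s ≤ u)
    (h1' : u ≤ t) (h2 : t ≤ T) :
    ‖R S g T n t s - R S g T n t u - S (t - u) (R S g T n u s)‖ ≤
      (M * K * T ^ μ) * ((1 / 2 : ℝ) ^ (μ - 1)) ^ n := by
  have hM := G.hM
  have hK := G.hK
  have sg := G.sg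
  have MK : 0 ≤ M * K := mul_nonneg (by linarith) hK
  have h1'' := h1.trans h1'
  rw [mul_assoc]
  refine le_trans ?_ (mul_le_mul_of_nonneg_left (cl_sum G.hμ hT n t s h0 h1'' h2) MK)
  unfold R
  rw [map_sum, ← Finset.sum_sub_distrib, ← Finset.sum_sub_distrib, Finset.mul_sum]
  refine (norm_sum_le _ _).trans (Finset.sum_le_sum fun i _ => ?_)
  have c1 : ∀ x, cl u t x = max u (cl s t x) := by intro x; unfold cl; grind
  have c2 : ∀ x, cl s u x = min u (cl s t x) := by intro x; unfold cl; grind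
  simp only [c1, c2]
  have m1 := cl_mono s t (gr_mono hT n (Nat.le_succ i))
  have l1 := le_cl s t (gr T n i)
  have l2 := cl_le h1'' (gr T n (i + 1))
  rw [Nat.succ_eq_add_one] at m1
  set a := cl s t (gr T n i)
  set b := cl s t (gr T n (i + 1))
  have gu := G.diag u (h0.trans h1) (h1'.trans h2)
  have nn : 0 ≤ M * K * (b - a) ^ μ := mul_nonneg MK (Real.rpow_nonneg (by linarith) _)
  rcases le_total u a with h | h
  · rw [max_eq_right h, max_eq_right (h.trans m1), min_eq_left h, min_eq_left (h.trans m1), gu]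
    simpa using nn
  rcases le_total b u with h' | h'
  · rw [max_eq_left h, max_eq_left h', min_eq_right h, min_eq_right h', gu,
      IsSG.comp sg (s := u - b) (t := t - u) (r := t - b) (by linarith) (by linarith) (by ring)]
    simpa using nn
  rw [max_eq_left h, max_eq_right h', min_eq_right h, min_eq_left h', sub_self, IsSG.zero sg]
  have d := G.hd b u a (h0.trans l1) h h' (l2.trans h2)
  have : S (t - b) (g b a) - S (t - b) (g b u) - S (t - u) (g u a) =
      S (t - b) (g b a - g b u - S (b - u) (g u a)) := by
    rw [map_sub, map_sub, IsSG.comp sg (s := b - u) (t := t - b) (r := t - u) (by linarith)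
      (by linarith) (by ring)]
  rw [this, mul_assoc]
  exact (IsSG.norm_le sg (by linarith) _).trans (mul_le_mul_of_nonneg_left d (by linarith))

lemma Good.near (G : Good S M T μ K g) (hT : 0 < T) (n : ℕ) (t s : ℝ) (h0 : 0 ≤ s) (h1 : s ≤ t)
    (h2 : t ≤ T) :
    ‖R S g T n t s - g t s‖ ≤ cst M μ * K * (t - s) ^ μ := by
  have := G.claim (fun i => cl s t (gr T n i)) ((cl_mono s t).comp (gr_mono hT n))
    (fun i => h0.trans (le_cl _ _ _)) (fun i => (cl_le h1 _).trans h2) (2 ^ n) 0 (2 ^ n)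
    (Nat.zero_le _) (Nat.sub_le _ _) 0 le_rfl
  simp only [gr_zero, gr_last, cl_bot h1 h0, cl_top h1 h2] at this
  rw [IsSG.zero G.sg] at this
  rw [← Finset.range_eq_Ico] at this
  exact this

lemma cl_cont (x : ℝ) : Continuous fun q : ℝ × ℝ => cl q.2 q.1 x := by
  unfold cl; fun_prop

lemma R_cont (sg : IsSG S M) (hM : 1 ≤ M) (hT : 0 < T)
    (hg : ContinuousOn (fun q : ℝ × ℝ => g q.1 q.2)
          {q : ℝ × ℝ | 0 ≤ q.2 ∧ q.2 ≤ q.1 ∧ q.1 ≤ T}) (n : ℕ) :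
    ContinuousOn (fun q : ℝ × ℝ => R S g T n q.1 q.2)
          {q : ℝ × ℝ | 0 ≤ q.2 ∧ q.2 ≤ q.1 ∧ q.1 ≤ T} := by
  have J : ContinuousOn (fun p : ℝ × B => S p.1 p.2) (Set.Ici 0 ×ˢ Set.univ) := by
    apply continuousOn_prod_of_continuousOn_lipschitzOnWith' _ (Real.toNNReal M)
    rotate_left
    · intro b _
      exact sg.2.2.1 b
    · intro a ha
      apply LipschitzOnWith.of_dist_le_mul
      intro x _ y _
      rw [dist_eq_norm, dist_eq_norm, Real.coe_toNNReal _ (by linarith)]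
      change ‖S a x - S a y‖ ≤ _
      rw [← map_sub]
      exact IsSG.norm_le sg ha _
  unfold R
  apply continuousOn_finsetSum
  intro i _
  have A : ContinuousOn (fun q : ℝ × ℝ => g (cl q.2 q.1 (gr T n (i + 1))) (cl q.2 q.1 (gr T n i)))
      {q : ℝ × ℝ | 0 ≤ q.2 ∧ q.2 ≤ q.1 ∧ q.1 ≤ T} := by
    refine hg.comp (f := fun q : ℝ × ℝ => (cl q.2 q.1 (gr T n (i + 1)), cl q.2 q.1 (gr T n i)))
      ((cl_cont _).prodMk (cl_cont _)).continuousOn ?_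
    rintro ⟨t, s⟩ ⟨h0, h1, h2⟩
    exact ⟨h0.trans (le_cl _ _ _), cl_mono _ _ (gr_mono hT n (Nat.le_succ i)),
      (cl_le h1 _).trans h2⟩
  refine J.comp (f := fun q : ℝ × ℝ => (q.1 - cl q.2 q.1 (gr T n (i + 1)),
    g (cl q.2 q.1 (gr T n (i + 1))) (cl q.2 q.1 (gr T n i)))) (ContinuousOn.prodMk
      (continuous_fst.sub (cl_cont _)).continuousOn A) ?_
  rintro ⟨t, s⟩ ⟨h0, h1, h2⟩
  exact ⟨sub_nonneg.2 (cl_le h1 _), trivial⟩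

lemma main [CompleteSpace B] (G : Good S M T μ K g) (hT : 0 < T)
    (hg : ContinuousOn (fun q : ℝ × ℝ => g q.1 q.2)
          {q : ℝ × ℝ | 0 ≤ q.2 ∧ q.2 ≤ q.1 ∧ q.1 ≤ T}) :
    ∃ F : ℝ → ℝ → B,
      ContinuousOn (fun q : ℝ × ℝ => F q.1 q.2)
        {q : ℝ × ℝ | 0 ≤ q.2 ∧ q.2 ≤ q.1 ∧ q.1 ≤ T} ∧
      (∀ t u s : ℝ, 0 ≤ s → s ≤ u → u ≤ t → t ≤ T →
        F t s = F t u + S (t - u) (F u s)) ∧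
      (∀ t s : ℝ, 0 ≤ s → s ≤ t → t ≤ T →
        Filter.Tendsto (fun n => R S g T n t s) Filter.atTop (nhds (F t s))) := by
  have hr : (1 / 2 : ℝ) ^ (μ - 1) < 1 :=
    Real.rpow_lt_one (by norm_num) (by norm_num) (by linarith [G.hμ])
  have hr0 : 0 ≤ (1 / 2 : ℝ) ^ (μ - 1) := by positivity
  have ex : ∀ t s : ℝ, ∃ L : B, 0 ≤ s → s ≤ t → t ≤ T →
      Filter.Tendsto (fun n => R S g T n t s) Filter.atTop (nhds L) := by
    intro t s
    by_cases h : 0 ≤ s ∧ s ≤ t ∧ t ≤ T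
    · obtain ⟨L, hL⟩ := cauchySeq_tendsto_of_complete (cauchySeq_of_le_geometric _ _ hr
        (fun n => G.step hT n t s h.1 h.2.1 h.2.2))
      exact ⟨L, fun _ _ _ => hL⟩
    · exact ⟨0, fun a b c => absurd ⟨a, b, c⟩ h⟩
  choose F hF using ex
  have z : Filter.Tendsto (fun n : ℕ => (M * K * T ^ μ) * ((1 / 2 : ℝ) ^ (μ - 1)) ^ n)
      Filter.atTop (nhds 0) := by
    simpa using (tendsto_pow_atTop_nhds_zero_of_lt_one hr0 hr).const_mul (M * K * T ^ μ)
  refine ⟨F, ?_, ?_, hF⟩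
  · have U : TendstoUniformlyOn (fun n (q : ℝ × ℝ) => R S g T n q.1 q.2)
        (fun q : ℝ × ℝ => F q.1 q.2) Filter.atTop
        {q : ℝ × ℝ | 0 ≤ q.2 ∧ q.2 ≤ q.1 ∧ q.1 ≤ T} := by
      rw [Metric.tendstoUniformlyOn_iff]
      intro ε hε
      have z' := z.div_const (1 - (1 / 2 : ℝ) ^ (μ - 1))
      rw [zero_div] at z'
      filter_upwards [z'.eventually (gt_mem_nhds hε)] with n hn
      rintro ⟨t, s⟩ ⟨h0, h1, h2⟩
      rw [dist_comm]
      exact (dist_le_of_le_geometric_of_tendsto _ _ hr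
        (fun n => G.step hT n t s h0 h1 h2) (hF t s h0 h1 h2) n).trans_lt hn
    exact U.continuousOn (Filter.Frequently.of_forall fun n => R_cont G.sg G.hM hT hg n)
  · intro t u s h0 h1 h1' h2
    have l := ((hF t s h0 (h1.trans h1') h2).sub (hF t u (h0.trans h1) h1' h2)).sub
      (((S (t - u)).continuous.tendsto _).comp (hF u s h0 h1 (h1'.trans h2)))
    have l' := squeeze_zero_norm (fun n => G.add hT n t u s h0 h1 h1' h2) z
    have := tendsto_nhds_unique l l'
    rw [sub_sub, sub_eq_zero] at this
    exact this

lemma conv (G : Good S M T μ K g) (F : ℝ → ℝ → B)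
    (hadd : ∀ t u s : ℝ, 0 ≤ s → s ≤ u → u ≤ t → t ≤ T →
        F t s = F t u + S (t - u) (F u s))
    (hn : ∀ t s : ℝ, 0 ≤ s → s ≤ t → t ≤ T → ‖F t s - g t s‖ ≤ cst M μ * K * (t - s) ^ μ)
    (t s : ℝ) (h0 : 0 ≤ s) (h1 : s < t) (h2 : t ≤ T) (d : ℝ) (n : ℕ) (x : ℕ → ℝ)
    (hx : Monotone x) (x0 : x 0 = s) (xn : x n = t) (hxt : ∀ i, x i ≤ t)
    (hd : ∀ i < n, x (i + 1) - x i < d) :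
    ‖(∑ i ∈ Finset.range n, S (t - x (i + 1)) (g (x (i + 1)) (x i))) - F t s‖ ≤
      M * (cst M μ * K) * (d ^ (μ - 1) * (t - s)) := by
  have hxs : ∀ i, 0 ≤ x i := fun i => h0.trans (x0 ▸ hx (Nat.zero_le i))
  have tel : ∀ m, F t (x 0) = F t (x m) +
      ∑ i ∈ Finset.range m, S (t - x (i + 1)) (F (x (i + 1)) (x i)) := by
    intro m
    induction m with
    | zero => simp
    | succ m ih =>
      rw [ih, Finset.sum_range_succ, hadd t (x (m + 1)) (x m) (hxs _) (hx (Nat.le_succ m))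
        (hxt _) h2]
      abel
  have tt : F t t = 0 := by
    have := hadd t t t (by linarith) le_rfl le_rfl h2
    rw [sub_self, IsSG.zero G.sg] at this
    simpa using this
  have := tel n
  rw [x0, xn, tt, zero_add] at this
  rw [this, ← Finset.sum_sub_distrib]
  have cK : 0 ≤ cst M μ * K := mul_nonneg (cst_pos G.hμ G.hM).le G.hK
  have hM : 0 ≤ M := by linarith [G.hM]
  have b := rpow_sum_le μ d G.hμ n x (fun i _ => hx (Nat.le_succ i)) (fun i hi => (hd i hi).le)
  rw [x0, xn] at b
  refine le_trans ?_ (mul_le_mul_of_nonneg_left b (mul_nonneg hM cK))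
  rw [Finset.mul_sum]
  refine (norm_sum_le _ _).trans (Finset.sum_le_sum fun i _ => ?_)
  rw [← map_sub, mul_assoc]
  refine (IsSG.norm_le G.sg (by linarith [hxt (i + 1)]) _).trans (mul_le_mul_of_nonneg_left ?_ hM)
  rw [norm_sub_rev]
  exact hn _ _ (hxs _) (hx (Nat.le_succ i)) ((hxt _).trans h2)

end Sew

/-- Convolutional integration of small increments: for `μ > 1` there is a constant
`c`, depending only on `μ` and the semigroup bound `M`, such that every `g ∈ Ĉ₂(B)`
with `‖δ̂g‖_μ < ∞` admits an exact (`δ̂F = 0`) increment `F` with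
`‖F − g‖_μ ≤ c ‖δ̂g‖_μ` which is the limit of the semigroup-weighted Riemann sums
`Σ S_{t − t_{i+1}} g_{t_{i+1} t_i}` as the mesh of the partition tends to `0`. -/
theorem stmt8 (μ : ℝ) (hμ : 1 < μ) (M : ℝ) (hM : 1 ≤ M) :
    ∃ c : ℝ, 0 < c ∧
      ∀ (B : Type u) [NormedAddCommGroup B] [NormedSpace ℝ B] [CompleteSpace B],
      ∀ T : ℝ, 0 < T → ∀ S : ℝ → B →L[ℝ] B, IsSG S M →
      ∀ g : ℝ → ℝ → B,
        ContinuousOn (fun q : ℝ × ℝ => g q.1 q.2)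
          {q : ℝ × ℝ | 0 ≤ q.2 ∧ q.2 ≤ q.1 ∧ q.1 ≤ T} →
        (∃ n hs ρ K,
          HatDecomp T μ (fun t u s => g t s - g t u - S (t - u) (g u s)) n hs ρ K) →
        ∃ F : ℝ → ℝ → B,
          ContinuousOn (fun q : ℝ × ℝ => F q.1 q.2)
            {q : ℝ × ℝ | 0 ≤ q.2 ∧ q.2 ≤ q.1 ∧ q.1 ≤ T} ∧
          (∀ t u s : ℝ, 0 ≤ s → s ≤ u → u ≤ t → t ≤ T →
            F t s = F t u + S (t - u) (F u s)) ∧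
          (∀ (n : ℕ) (hs : Fin n → ℝ → ℝ → ℝ → B) (ρ K : Fin n → ℝ),
            HatDecomp T μ (fun t u s => g t s - g t u - S (t - u) (g u s)) n hs ρ K →
            ∀ t s : ℝ, 0 ≤ s → s ≤ t → t ≤ T →
              ‖F t s - g t s‖ ≤ c * (∑ i, K i) * (t - s) ^ μ) ∧
          ∀ t s : ℝ, 0 ≤ s → s < t → t ≤ T → ∀ ε : ℝ, 0 < ε → ∃ δ : ℝ, 0 < δ ∧
            ∀ (n : ℕ) (π : ℕ → ℝ), π 0 = s → π n = t →
              (∀ i < n, π i < π (i + 1)) → (∀ i < n, π (i + 1) - π i < δ) →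
              ‖(∑ i ∈ Finset.range n, S (t - π (i + 1)) (g (π (i + 1)) (π i))) - F t s‖ < ε := by
  refine ⟨Sew.cst M μ, Sew.cst_pos hμ hM, ?_⟩
  intro B _ _ _ T hT S sg g hg hex
  have mk : ∀ (n : ℕ) (hs : Fin n → ℝ → ℝ → ℝ → B) (ρ K : Fin n → ℝ),
      HatDecomp T μ (fun t u s => g t s - g t u - S (t - u) (g u s)) n hs ρ K →
      Sew.Good S M T μ (∑ i, K i) g := fun n hs ρ K H =>
    ⟨sg, hμ, hM, Finset.sum_nonneg fun i _ => H.2.1 i, Sew.decomp_bound T μ hμ _ n hs ρ K H⟩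
  obtain ⟨n0, hs0, ρ0, K0, H0⟩ := hex
  have G0 := mk n0 hs0 ρ0 K0 H0
  obtain ⟨F, Fc, Fa, Fl⟩ := Sew.main G0 hT hg
  have bd : ∀ (n : ℕ) (hs : Fin n → ℝ → ℝ → ℝ → B) (ρ K : Fin n → ℝ),
      HatDecomp T μ (fun t u s => g t s - g t u - S (t - u) (g u s)) n hs ρ K →
      ∀ t s : ℝ, 0 ≤ s → s ≤ t → t ≤ T →
        ‖F t s - g t s‖ ≤ Sew.cst M μ * (∑ i, K i) * (t - s) ^ μ := by
    intro n hs ρ K H t s h0 h1 h2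
    exact le_of_tendsto ((Fl t s h0 h1 h2).sub_const (g t s)).norm
      (Filter.Eventually.of_forall fun k => (mk n hs ρ K H).near hT k t s h0 h1 h2)
  refine ⟨F, Fc, Fa, bd, ?_⟩
  intro t s h0 h1 h2 ε hε
  set K := ∑ i, K0 i with hK
  have cK : 0 ≤ M * (Sew.cst M μ * K) * (t - s) :=
    mul_nonneg (mul_nonneg (by linarith) (mul_nonneg (Sew.cst_pos hμ hM).le G0.hK)) (by linarith)
  set A := M * (Sew.cst M μ * K) * (t - s) with hA
  have hq : 0 < ε / (A + 1) := by positivity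
  refine ⟨(ε / (A + 1)) ^ (1 / (μ - 1)), by positivity, ?_⟩
  intro n π p0 pn pm pd
  have hx : Monotone fun i => π (min i n) := by
    apply monotone_nat_of_le_succ
    intro i
    rcases Nat.lt_or_ge i n with h | h
    · rw [min_eq_left h.le, min_eq_left (by omega)]
      exact (pm i h).le
    · rw [min_eq_right h, min_eq_right (by omega)]
  have := Sew.conv G0 F Fa (bd n0 hs0 ρ0 K0 H0) t s h0 h1 h2 ((ε / (A + 1)) ^ (1 / (μ - 1))) n
    (fun i => π (min i n)) hx (by simpa using p0) (by simpa using pn)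
    (fun i => by
      have := hx (le_max_left i n)
      simpa [pn] using this)
    (fun i hi => by
      rw [min_eq_left hi.le, min_eq_left (by omega)]
      exact pd i hi)
  have es : ∑ i ∈ Finset.range n, S (t - π (min (i + 1) n)) (g (π (min (i + 1) n)) (π (min i n)))
      = ∑ i ∈ Finset.range n, S (t - π (i + 1)) (g (π (i + 1)) (π i)) := by
    apply Finset.sum_congr rfl
    intro i hi
    have hi := Finset.mem_range.1 hi
    rw [min_eq_left hi.le, min_eq_left (by omega)]
  rw [es, ← Real.rpow_mul hq.le, one_div_mul_cancel (by linarith), Real.rpow_one] at this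
  refine this.trans_lt ?_
  have : M * (Sew.cst M μ * K) * (ε / (A + 1) * (t - s)) = A * ε / (A + 1) := by
    rw [hA]; ring
  rw [this, div_lt_iff₀ (by linarith)]
  nlinarith
end

section
/- (Garsia–Rodemich–Rumsey-type bound for convolutional increments.) For every γ > 0 and p ≥ 1 there exists a constant C, depending only on γ, p, T and the semigroup bound M, such that for every continuous R : 𝒮_2 → L(B) vanishing on the diagonal, ‖R‖_γ ≤ C ( U_{γ+2/p, p}(R) + ‖δ̃R‖_γ ), where ‖R‖_γ := sup_{(t,s)∈𝒮_2, t>s} ‖R_{ts}‖/(t−s)^γ, U_{κ,p}(R) := ( ∫∫_{𝒮_2} (‖R_{ts}‖/(t−s)^κ)^p dt ds )^{1/p}, and ‖δ̃R‖_γ := sup_{(t,u,s)∈𝒮_3, t>s} ‖(δ̃R)_{tus}‖/(t−s)^γ. -/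
open MeasureTheory
open scoped ENNReal

universe u

open Filter Topology Set

/-- Normalized Lebesgue measure on the middle half of `[0, l]`. -/
noncomputable def midMeas (l : ℝ) : Measure ℝ :=
  ENNReal.ofReal (2 / l) • (volume.restrict (Icc (l / 4) (3 * l / 4)))

lemma midMeas_prob {l : ℝ} (hl : 0 < l) : IsProbabilityMeasure (midMeas l) := by
  constructor
  simp only [midMeas, Measure.smul_apply, Measure.restrict_apply MeasurableSet.univ,
    univ_inter, Real.volume_Icc, smul_eq_mul]
  rw [← ENNReal.ofReal_mul (by positivity), ← ENNReal.ofReal_one]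
  congr 1
  field_simp
  ring

lemma midMeas_ae (l : ℝ) : ∀ᵐ x ∂(midMeas l), x ∈ Icc (l / 4) (3 * l / 4) :=
  Measure.ae_smul_measure (ae_restrict_mem measurableSet_Icc) _

lemma midMeas_lintegral_le (l : ℝ) (f : ℝ → ℝ≥0∞) :
    ∫⁻ x, f x ∂(midMeas l) ≤ ENNReal.ofReal (2 / l) * ∫⁻ x, f x := by
  rw [midMeas, lintegral_smul_measure, smul_eq_mul]
  gcongr
  exact Measure.restrict_le_self

lemma kbound (γ p l : ℝ) (hp : 1 ≤ p) (hl : 0 < l) (U : ℝ≥0∞)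
    (k G : ℝ → ℝ → ℝ≥0∞) (hk : Measurable (Function.uncurry k))
    (hγ : 0 < γ)
    (h3 : ∀ x y, 0 ≤ x → x ≤ y → y ≤ l → k x y ^ p ≤ G x y * ENNReal.ofReal (y ^ (γ * p + 2)))
    (h4 : ∫⁻ x, ∫⁻ y, G x y ≤ U ^ p) :
    ∫⁻ x, ∫⁻ y, k x y ∂(midMeas l) ∂(midMeas (l / 4)) ≤ 16 * U * ENNReal.ofReal (l ^ γ) := by
  have hp0 : 0 < p := by linarith
  have := midMeas_prob hl
  have := midMeas_prob (l := l / 4) (by positivity)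
  have e1 : ∫⁻ x, ∫⁻ y, k x y ∂(midMeas l) ∂(midMeas (l / 4)) =
      ∫⁻ z, Function.uncurry k z ∂((midMeas (l / 4)).prod (midMeas l)) := by
    rw [lintegral_prod _ hk.aemeasurable]; rfl
  have e2 := eLpNorm'_le_eLpNorm'_of_exponent_le (p := 1) (q := p) one_pos hp
    ((midMeas (l / 4)).prod (midMeas l)) (f := Function.uncurry k) hk.aestronglyMeasurable
  simp only [eLpNorm', enorm_eq_self, ENNReal.rpow_one, div_one] at e2
  rw [e1]
  refine e2.trans ?_
  have e3 : ∫⁻ z, Function.uncurry k z ^ p ∂((midMeas (l / 4)).prod (midMeas l)) ≤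
      ENNReal.ofReal (16 / l ^ 2 * l ^ (γ * p + 2)) * U ^ p := by
    rw [lintegral_prod _ (hk.pow_const p).aemeasurable]
    calc ∫⁻ x, ∫⁻ y, k x y ^ p ∂(midMeas l) ∂(midMeas (l / 4))
        ≤ ∫⁻ x, ∫⁻ y, ENNReal.ofReal (l ^ (γ * p + 2)) * G x y ∂(midMeas l) ∂(midMeas (l / 4)) := by
          refine lintegral_mono_ae ?_
          filter_upwards [midMeas_ae (l / 4)] with x hx
          refine lintegral_mono_ae ?_
          filter_upwards [midMeas_ae l] with y hy
          have hx1 := hx.1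
          have hx2 := hx.2
          have hy1 := hy.1
          have hy2 := hy.2
          refine (h3 x y (by linarith) (by linarith) (by linarith)).trans ?_
          rw [mul_comm]
          gcongr
          · linarith
          · linarith
      _ ≤ ∫⁻ x, (ENNReal.ofReal (2 / l) * (ENNReal.ofReal (l ^ (γ * p + 2)) * ∫⁻ y, G x y))
            ∂(midMeas (l / 4)) := by
          refine lintegral_mono fun x => ?_
          refine (midMeas_lintegral_le _ _).trans ?_
          rw [lintegral_const_mul' _ _ ENNReal.ofReal_ne_top]
      _ ≤ ENNReal.ofReal (2 / (l / 4)) * (ENNReal.ofReal (2 / l) *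
            (ENNReal.ofReal (l ^ (γ * p + 2)) * ∫⁻ x, ∫⁻ y, G x y)) := by
          refine (midMeas_lintegral_le _ _).trans ?_
          rw [lintegral_const_mul' _ _ ENNReal.ofReal_ne_top,
            lintegral_const_mul' _ _ ENNReal.ofReal_ne_top]
      _ ≤ _ := by
          rw [← mul_assoc, ← mul_assoc, ← ENNReal.ofReal_mul (by positivity),
            ← ENNReal.ofReal_mul (by positivity)]
          refine mul_le_mul' (le_of_eq ?_) h4
          congr 1
          field_simp
          norm_num
  calc _ ≤ (ENNReal.ofReal (16 / l ^ 2 * l ^ (γ * p + 2)) * U ^ p) ^ (1 / p) := by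
        exact ENNReal.rpow_le_rpow e3 (by positivity)
    _ = ENNReal.ofReal ((16 / l ^ 2 * l ^ (γ * p + 2)) ^ (1 / p)) * U := by
        rw [ENNReal.mul_rpow_of_nonneg _ _ (by positivity), ← ENNReal.rpow_mul,
          mul_one_div_cancel hp0.ne', ENNReal.rpow_one,
          ENNReal.ofReal_rpow_of_nonneg (by positivity) (by positivity)]
    _ ≤ ENNReal.ofReal (16 * l ^ γ) * U := by
        gcongr
        have : (16 / l ^ 2 * l ^ (γ * p + 2)) = 16 * (l ^ γ) ^ p := by
          rw [Real.rpow_add hl, Real.rpow_mul hl.le, Real.rpow_two]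
          field_simp
        rw [this, Real.mul_rpow (by positivity) (by positivity), ← Real.rpow_mul (by positivity),
          mul_one_div_cancel hp0.ne', Real.rpow_one]
        gcongr
        calc (16 : ℝ) ^ (1 / p) ≤ 16 ^ (1 : ℝ) := by
              apply Real.rpow_le_rpow_of_exponent_le (by norm_num)
              rw [div_le_one hp0]; exact hp
          _ = 16 := Real.rpow_one _
    _ = _ := by
        rw [ENNReal.ofReal_mul (by norm_num)]
        simp only [ENNReal.ofReal_ofNat]
        ring

lemma one_step (γ p l : ℝ) (hp : 1 ≤ p) (hl : 0 < l) (U D : ℝ≥0∞)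
    (H : ℝ → ℝ≥0∞) (hH : Measurable H)
    (k G : ℝ → ℝ → ℝ≥0∞) (hk : Measurable (Function.uncurry k))
    (hγ : 0 < γ)
    (h1 : ∀ x y, 0 ≤ x → x ≤ y → y ≤ l → H y ≤ H x + k x y + D * ENNReal.ofReal (y ^ γ))
    (h3 : ∀ x y, 0 ≤ x → x ≤ y → y ≤ l → k x y ^ p ≤ G x y * ENNReal.ofReal (y ^ (γ * p + 2)))
    (h4 : ∫⁻ x, ∫⁻ y, G x y ≤ U ^ p) :
    ∫⁻ y, H y ∂(midMeas l) ≤ ∫⁻ x, H x ∂(midMeas (l / 4)) +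
      (16 * U + D) * ENNReal.ofReal (l ^ γ) := by
  have := midMeas_prob hl
  have := midMeas_prob (l := l / 4) (by positivity)
  calc ∫⁻ y, H y ∂(midMeas l) = ∫⁻ x, ∫⁻ y, H y ∂(midMeas l) ∂(midMeas (l / 4)) := by simp
    _ ≤ ∫⁻ x, ∫⁻ y, (H x + (k x y + D * ENNReal.ofReal (l ^ γ))) ∂(midMeas l)
          ∂(midMeas (l / 4)) := by
        refine lintegral_mono_ae ?_
        filter_upwards [midMeas_ae (l / 4)] with x hx
        refine lintegral_mono_ae ?_
        filter_upwards [midMeas_ae l] with y hy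
        have hx1 := hx.1
        have hx2 := hx.2
        have hy1 := hy.1
        have hy2 := hy.2
        refine (h1 x y (by linarith) (by linarith) (by linarith)).trans ?_
        rw [← add_assoc]
        gcongr
        · linarith
        · linarith
    _ = ∫⁻ x, (H x + (∫⁻ y, k x y ∂(midMeas l) + D * ENNReal.ofReal (l ^ γ)))
          ∂(midMeas (l / 4)) := by
        refine lintegral_congr fun x => ?_
        rw [lintegral_add_left measurable_const, lintegral_add_right _ measurable_const]
        simp
    _ = ∫⁻ x, H x ∂(midMeas (l / 4)) + (∫⁻ x, ∫⁻ y, k x y ∂(midMeas l) ∂(midMeas (l / 4))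
          + D * ENNReal.ofReal (l ^ γ)) := by
        rw [lintegral_add_left hH, lintegral_add_right _ measurable_const]
        simp
    _ ≤ _ := by
        rw [add_mul]
        gcongr
        exact kbound γ p l hp hl U k G hk hγ h3 h4

lemma one_sided (γ p d : ℝ) (hp : 1 ≤ p) (hd : 0 < d) (U D : ℝ≥0∞)
    (H : ℝ → ℝ≥0∞) (hH : Measurable H)
    (k G : ℝ → ℝ → ℝ≥0∞) (hk : Measurable (Function.uncurry k))
    (hγ : 0 < γ)
    (h1 : ∀ x y, 0 ≤ x → x ≤ y → y ≤ d → H y ≤ H x + k x y + D * ENNReal.ofReal (y ^ γ))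
    (h2 : Tendsto H (𝓝[≥] 0) (𝓝 0))
    (h3 : ∀ x y, 0 ≤ x → x ≤ y → y ≤ d → k x y ^ p ≤ G x y * ENNReal.ofReal (y ^ (γ * p + 2)))
    (h4 : ∫⁻ x, ∫⁻ y, G x y ≤ U ^ p) :
    ∫⁻ y, H y ∂(midMeas d) ≤
      (16 * U + D) * ENNReal.ofReal ((1 - (1 / 4 : ℝ) ^ γ)⁻¹ * d ^ γ) := by
  set q : ℝ := (1 / 4 : ℝ) ^ γ with hq
  have hq0 : 0 ≤ q := by positivity
  have hq1 : q < 1 := Real.rpow_lt_one (by norm_num) (by norm_num) hγ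
  have hln : ∀ n : ℕ, 0 < d * (1 / 4) ^ n := fun n => by positivity
  have hld : ∀ n : ℕ, d * (1 / 4) ^ n ≤ d := fun n => by
    have : ((1 / 4 : ℝ)) ^ n ≤ 1 := pow_le_one₀ (by norm_num) (by norm_num)
    nlinarith
  have key : ∀ n : ℕ, ∫⁻ y, H y ∂(midMeas d) ≤ ∫⁻ y, H y ∂(midMeas (d * (1 / 4) ^ n)) +
      (16 * U + D) * ENNReal.ofReal ((∑ i ∈ Finset.range n, q ^ i) * d ^ γ) := by
    intro n
    induction n with
    | zero => simp
    | succ n ih =>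
      refine ih.trans ?_
      have := one_step γ p (d * (1 / 4) ^ n) hp (hln n) U D H hH k G hk hγ
        (fun x y a b c => h1 x y a b (c.trans (hld n)))
        (fun x y a b c => h3 x y a b (c.trans (hld n))) h4
      have e : d * (1 / 4) ^ n / 4 = d * (1 / 4) ^ (n + 1) := by ring
      rw [e] at this
      have e2 : (d * (1 / 4) ^ n) ^ γ = q ^ n * d ^ γ := by
        rw [Real.mul_rpow hd.le (by positivity), hq, ← Real.rpow_natCast, ← Real.rpow_natCast,
          ← Real.rpow_mul (by norm_num), ← Real.rpow_mul (by norm_num), mul_comm γ, mul_comm]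
      rw [e2] at this
      rw [Finset.sum_range_succ, add_mul (Finset.sum _ _), ENNReal.ofReal_add (by positivity) (by positivity),
        mul_add, add_comm ((16 * U + D) * _) , ← add_assoc]
      gcongr
  have key2 : ∀ ε : ℝ≥0∞, 0 < ε → ∫⁻ y, H y ∂(midMeas d) ≤
      (16 * U + D) * ENNReal.ofReal ((1 - q)⁻¹ * d ^ γ) + ε := by
    intro ε hε
    have h5 : ∀ᶠ x in 𝓝[≥] (0 : ℝ), H x < ε := h2 (Iio_mem_nhds hε)
    rw [eventually_nhdsWithin_iff, Metric.eventually_nhds_iff] at h5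
    obtain ⟨δ, hδ, h5⟩ := h5
    obtain ⟨n, hn⟩ := exists_pow_lt_of_lt_one (show 0 < δ / d by positivity)
      (show (1 / 4 : ℝ) < 1 by norm_num)
    have hn' : d * (1 / 4) ^ n < δ := by
      rw [lt_div_iff₀ hd] at hn; linarith
    refine (key n).trans ?_
    rw [add_comm]
    gcongr
    · rw [← tsum_geometric_of_lt_one hq0 hq1]
      exact (summable_geometric_of_lt_one hq0 hq1).sum_le_tsum _ (fun i _ => by positivity)
    · have := midMeas_prob (hln n)
      calc _ ≤ ∫⁻ y, ε ∂(midMeas (d * (1 / 4) ^ n)) := by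
            refine lintegral_mono_ae ?_
            filter_upwards [midMeas_ae (d * (1 / 4) ^ n)] with y hy
            have hy1 := hy.1
            have hy2 := hy.2
            have h0 := hln n
            refine (h5 ?_ ?_).le
            · rw [Real.dist_eq, sub_zero, abs_of_nonneg (by linarith)]
              linarith
            · show 0 ≤ y
              linarith
        _ = ε := by rw [lintegral_const, measure_univ, mul_one]
  exact le_of_forall_pos_le_add fun ε hε => key2 ε hε

lemma midMeas_reflect (l : ℝ) (f : ℝ → ℝ≥0∞) :
    ∫⁻ x, f (l - x) ∂(midMeas l) = ∫⁻ x, f x ∂(midMeas l) := by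
  simp only [midMeas, lintegral_smul_measure]
  congr 1
  rw [← lintegral_indicator measurableSet_Icc, ← lintegral_indicator measurableSet_Icc,
    ← lintegral_sub_left_eq_self _ l]
  refine lintegral_congr fun x => ?_
  by_cases hx : x ∈ Icc (l / 4) (3 * l / 4)
  · have hx' : l - x ∈ Icc (l / 4) (3 * l / 4) := ⟨by linarith [hx.2], by linarith [hx.1]⟩
    simp [indicator_of_mem hx, indicator_of_mem hx']
  · have hx' : l - x ∉ Icc (l / 4) (3 * l / 4) := fun h =>
      hx ⟨by linarith [h.2], by linarith [h.1]⟩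
    rw [indicator_of_notMem hx, indicator_of_notMem hx']

lemma scalar_grr (γ p T : ℝ) (hp : 1 ≤ p) (hγ : 0 < γ) (U D : ℝ≥0∞)
    (r F : ℝ → ℝ → ℝ≥0∞) (hr : Measurable (Function.uncurry r))
    (hF : Measurable (Function.uncurry F))
    (h1 : ∀ t u s, 0 ≤ s → s ≤ u → u ≤ t → t ≤ T →
      r t s ≤ r t u + r u s + D * ENNReal.ofReal ((t - s) ^ γ))
    (h2a : ∀ t, 0 ≤ t → t ≤ T → Tendsto (fun x => r t (t - x)) (𝓝[≥] 0) (𝓝 0))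
    (h2b : ∀ s, 0 ≤ s → s ≤ T → Tendsto (fun x => r (s + x) s) (𝓝[≥] 0) (𝓝 0))
    (h3 : ∀ t s, 0 ≤ s → s ≤ t → t ≤ T →
      r t s ^ p ≤ F t s * ENNReal.ofReal ((t - s) ^ (γ * p + 2)))
    (h4 : ∫⁻ t, ∫⁻ s, F t s ≤ U ^ p) (t s : ℝ) (hs : 0 ≤ s) (hst : s < t) (ht : t ≤ T) :
    r t s ≤ (2 * ((16 * U + D) * ENNReal.ofReal ((1 - (1 / 4 : ℝ) ^ γ)⁻¹)) + D) *
      ENNReal.ofReal ((t - s) ^ γ) := by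
  have hp0 : 0 < p := by linarith
  have hq1 : (1 / 4 : ℝ) ^ γ < 1 := Real.rpow_lt_one (by norm_num) (by norm_num) hγ
  have hd : 0 < t - s := by linarith
  have up := one_sided γ p (t - s) hp hd U D (fun x => r t (t - x))
    (hr.comp (measurable_const.prodMk (measurable_const.sub measurable_id)))
    (fun x y => r (t - x) (t - y)) (fun x y => F (t - x) (t - y))
    (hr.comp ((measurable_const.sub measurable_fst).prodMk
      (measurable_const.sub measurable_snd))) hγ
    (fun x y hx hxy hy => by
      have := h1 t (t - x) (t - y) (by linarith) (by linarith) (by linarith) (by linarith)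
      simpa using this)
    (h2a t (by linarith) ht)
    (fun x y hx hxy hy => by
      refine (h3 (t - x) (t - y) (by linarith) (by linarith) (by linarith)).trans ?_
      gcongr
      · linarith
      · linarith)
    (by
      rw [lintegral_sub_left_eq_self (fun x => ∫⁻ y, F x (t - y)) t]
      simp_rw [fun x => lintegral_sub_left_eq_self (μ := volume) (fun y => F x y) t]
      exact h4)
  have low := one_sided γ p (t - s) hp hd U D (fun x => r (s + x) s)
    (hr.comp ((measurable_const.add measurable_id).prodMk measurable_const))
    (fun x y => r (s + y) (s + x)) (fun x y => F (s + y) (s + x))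
    (hr.comp ((measurable_const.add measurable_snd).prodMk
      (measurable_const.add measurable_fst))) hγ
    (fun x y hx hxy hy => by
      have := h1 (s + y) (s + x) s (by linarith) (by linarith) (by linarith) (by linarith)
      simpa [add_comm] using this)
    (h2b s hs (by linarith))
    (fun x y hx hxy hy => by
      refine (h3 (s + y) (s + x) (by linarith) (by linarith) (by linarith)).trans ?_
      gcongr
      · linarith
      · linarith)
    (by
      rw [lintegral_add_left_eq_self (fun x => ∫⁻ y, F (s + y) x) s]
      simp_rw [fun x => lintegral_add_left_eq_self (μ := volume) (fun y => F y x) s]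
      rw [lintegral_lintegral_swap]
      · exact h4
      · exact (hF.comp measurable_swap).aemeasurable)
  have := midMeas_prob hd
  calc r t s = ∫⁻ x, r t s ∂(midMeas (t - s)) := by rw [lintegral_const, measure_univ, mul_one]
    _ ≤ ∫⁻ x, (r t (t - x) + r (s + (t - s - x)) s + D * ENNReal.ofReal ((t - s) ^ γ))
          ∂(midMeas (t - s)) := by
        refine lintegral_mono_ae ?_
        filter_upwards [midMeas_ae (t - s)] with x hx
        have hx1 := hx.1
        have hx2 := hx.2
        have e : s + (t - s - x) = t - x := by ring
        rw [e]
        exact h1 t (t - x) s hs (by linarith) (by linarith) ht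
    _ = ∫⁻ x, r t (t - x) ∂(midMeas (t - s)) + ∫⁻ x, r (s + x) s ∂(midMeas (t - s)) +
          D * ENNReal.ofReal ((t - s) ^ γ) := by
        rw [lintegral_add_right _ measurable_const, lintegral_add_left, lintegral_const,
          measure_univ, mul_one, midMeas_reflect (t - s) (fun x => r (s + x) s)]
        exact (hr.comp (measurable_const.prodMk (measurable_const.sub measurable_id)))
    _ ≤ _ := by
        refine (add_le_add_left (add_le_add up low) _).trans_eq ?_
        rw [ENNReal.ofReal_mul (by rw [inv_nonneg]; linarith)]
        ring

lemma clm_enorm_zero {B : Type u} [NormedAddCommGroup B] [NormedSpace ℝ B] :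
    ‖(0 : B →L[ℝ] B)‖ₑ = 0 := by
  rw [← ofReal_norm, norm_zero, ENNReal.ofReal_zero]

lemma clm_enorm_add_le {B : Type u} [NormedAddCommGroup B] [NormedSpace ℝ B]
    (X Y : B →L[ℝ] B) : ‖X + Y‖ₑ ≤ ‖X‖ₑ + ‖Y‖ₑ := by
  rw [← ofReal_norm, ← ofReal_norm, ← ofReal_norm,
    ← ENNReal.ofReal_add (norm_nonneg _) (norm_nonneg _)]
  exact ENNReal.ofReal_le_ofReal (norm_add_le X Y)

/-- A Garsia–Rodemich–Rumsey-type bound for convolutional operator-valued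
increments: `‖R‖_γ ≤ C (U_{γ+2/p, p}(R) + ‖δ̃R‖_γ)`, with
`(δ̃R)_{tus} = R_{ts} − R_{tu} S_{us} − S_{tu} R_{us}`, the constant `C` depending
only on `γ`, `p`, `T` and the semigroup bound `M`. -/
theorem stmt10 (γ : ℝ) (hγ : 0 < γ) (p : ℝ) (hp : 1 ≤ p) (T : ℝ) (hT : 0 < T)
    (M : ℝ) (hM : 1 ≤ M) :
    ∃ C : ℝ, 0 < C ∧
      ∀ (B : Type u) [NormedAddCommGroup B] [NormedSpace ℝ B] [CompleteSpace B],
      ∀ S : ℝ → B →L[ℝ] B, IsSG S M →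
      ∀ R : ℝ → ℝ → B →L[ℝ] B,
        ContinuousOn (fun q : ℝ × ℝ => R q.1 q.2)
          {q : ℝ × ℝ | 0 ≤ q.2 ∧ q.2 ≤ q.1 ∧ q.1 ≤ T} →
        (∀ t ∈ Set.Icc (0 : ℝ) T, R t t = 0) →
        (⨆ q : {q : ℝ × ℝ // 0 ≤ q.2 ∧ q.2 ≤ q.1 ∧ q.1 ≤ T},
            ENNReal.ofReal (‖R q.1.1 q.1.2‖ / (q.1.1 - q.1.2) ^ γ)) ≤
          ENNReal.ofReal C *
            ((∫⁻ q in {q : ℝ × ℝ | 0 ≤ q.2 ∧ q.2 ≤ q.1 ∧ q.1 ≤ T},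
                ENNReal.ofReal ((‖R q.1 q.2‖ / (q.1 - q.2) ^ (γ + 2 / p)) ^ p)) ^ (1 / p) +
              ⨆ q : {q : ℝ × ℝ × ℝ // 0 ≤ q.2.2 ∧ q.2.2 ≤ q.2.1 ∧ q.2.1 ≤ q.1 ∧ q.1 ≤ T},
                ENNReal.ofReal
                  (‖R q.1.1 q.1.2.2 - (R q.1.1 q.1.2.1).comp (S (q.1.2.1 - q.1.2.2)) -
                      (S (q.1.1 - q.1.2.1)).comp (R q.1.2.1 q.1.2.2)‖ /
                    (q.1.1 - q.1.2.2) ^ γ)) := by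
  have hp0 : 0 < p := by linarith
  have hq1 : (1 / 4 : ℝ) ^ γ < 1 := Real.rpow_lt_one (by norm_num) (by norm_num) hγ
  have hc0 : 0 < (1 - (1 / 4 : ℝ) ^ γ)⁻¹ := by rw [inv_pos]; linarith
  set c : ℝ := (1 - (1 / 4 : ℝ) ^ γ)⁻¹ with hc
  refine ⟨(34 * c + 1) * (M * M), by positivity, ?_⟩
  intro B _ _ _ S hS R hR hR0
  obtain ⟨hS0, hSadd, -, hSM⟩ := hS
  set A : Set (ℝ × ℝ) := {q : ℝ × ℝ | 0 ≤ q.2 ∧ q.2 ≤ q.1 ∧ q.1 ≤ T} with hA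
  set V : ℝ≥0∞ := ∫⁻ q in A,
    ENNReal.ofReal ((‖R q.1 q.2‖ / (q.1 - q.2) ^ (γ + 2 / p)) ^ p) with hV
  set N : ℝ≥0∞ := ⨆ q : {q : ℝ × ℝ × ℝ // 0 ≤ q.2.2 ∧ q.2.2 ≤ q.2.1 ∧ q.2.1 ≤ q.1 ∧ q.1 ≤ T},
                ENNReal.ofReal
                  (‖R q.1.1 q.1.2.2 - (R q.1.1 q.1.2.1).comp (S (q.1.2.1 - q.1.2.2)) -
                      (S (q.1.1 - q.1.2.1)).comp (R q.1.2.1 q.1.2.2)‖ /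
                    (q.1.1 - q.1.2.2) ^ γ) with hN
  have hAm : MeasurableSet A := by
    apply IsClosed.measurableSet
    exact (isClosed_le continuous_const continuous_snd).inter
      ((isClosed_le continuous_snd continuous_fst).inter
        (isClosed_le continuous_fst continuous_const))
  -- the clamped extension of R
  obtain ⟨R', hR'c, hR'e⟩ : ∃ R' : ℝ → ℝ → B →L[ℝ] B,
      Continuous (fun q : ℝ × ℝ => R' q.1 q.2) ∧
      ∀ t s, 0 ≤ s → s ≤ t → t ≤ T → R' t s = R t s := by
    refine ⟨fun t s => R (max (max 0 (min s T)) (min t T)) (max 0 (min s T)), ?_, ?_⟩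
    · have : Continuous (fun q : ℝ × ℝ =>
          ((max (max 0 (min q.2 T)) (min q.1 T), max 0 (min q.2 T)) : ℝ × ℝ)) := by fun_prop
      refine hR.comp_continuous this ?_
      intro q
      refine ⟨le_max_left _ _, le_max_left _ _, ?_⟩
      exact max_le (max_le hT.le (min_le_right _ _)) (min_le_right _ _)
    · intro t s h0 hst ht
      have e1 : min s T = s := min_eq_left (by linarith)
      have e2 : min t T = t := min_eq_left ht
      simp only [e1, e2, max_eq_right h0, max_eq_right hst]
  set r : ℝ → ℝ → ℝ≥0∞ := fun t s => ⨆ ab : NNReal × NNReal,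
    ‖(S ab.1).comp ((R' t s).comp (S ab.2))‖ₑ with hr
  have hSe : ∀ a : NNReal, ‖S a‖ₑ ≤ ENNReal.ofReal M := fun a => by
    rw [← ofReal_norm]
    exact ENNReal.ofReal_le_ofReal (hSM a a.2)
  have hcomp : ∀ (a b : NNReal) (X : B →L[ℝ] B),
      ‖(S a).comp (X.comp (S b))‖ₑ ≤ ENNReal.ofReal (M * M) * ‖X‖ₑ := by
    intro a b X
    calc _ ≤ ‖S a‖ₑ * (‖X‖ₑ * ‖S b‖ₑ) :=
          (ContinuousLinearMap.opENorm_comp_le _ _).trans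
            (mul_le_mul' le_rfl (ContinuousLinearMap.opENorm_comp_le _ _))
      _ ≤ ENNReal.ofReal M * (‖X‖ₑ * ENNReal.ofReal M) := by
          gcongr
          · exact hSe a
          · exact hSe b
      _ = _ := by rw [ENNReal.ofReal_mul (by linarith)]; ring
  have hrle : ∀ t s, r t s ≤ ENNReal.ofReal (M * M) * ‖R' t s‖ₑ := fun t s =>
    iSup_le fun ab => hcomp _ _ _
  have hler : ∀ t s, ‖R' t s‖ₑ ≤ r t s := fun t s => by
    refine le_trans (le_of_eq ?_) (le_iSup _ ((0, 0) : NNReal × NNReal))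
    simp [hS0]
  have hrm : Measurable (Function.uncurry r) := by
    apply LowerSemicontinuous.measurable
    refine lowerSemicontinuous_iSup (f := fun (ab : NNReal × NNReal) (q : ℝ × ℝ) =>
      ‖(S ab.1).comp ((R' q.1 q.2).comp (S ab.2))‖ₑ) fun ab => ?_
    apply Continuous.lowerSemicontinuous
    exact (continuous_const.clm_comp (hR'c.clm_comp continuous_const)).enorm
  set W : ℝ × ℝ → ℝ≥0∞ := A.indicator
    (fun q => ENNReal.ofReal ((‖R' q.1 q.2‖ / (q.1 - q.2) ^ (γ + 2 / p)) ^ p)) with hW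
  have hWm : Measurable W := by
    refine Measurable.indicator ?_ hAm
    have h0 : Measurable (fun q : ℝ × ℝ => ‖R' q.1 q.2‖) := hR'c.norm.measurable
    fun_prop
  have hWV : ∫⁻ q, W q = V := by
    rw [hW, lintegral_indicator hAm]
    refine setLIntegral_congr_fun hAm fun q hq => ?_
    simp only [hR'e q.1 q.2 hq.1 hq.2.1 hq.2.2]
  have hzero : ∀ t, 0 ≤ t → t ≤ T → R' t t = 0 := fun t h0 h1 => by
    rw [hR'e t t h0 le_rfl h1]; exact hR0 t ⟨h0, h1⟩
  have htend : ∀ f : ℝ → ℝ × ℝ, Continuous f → R' (f 0).1 (f 0).2 = 0 →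
      Tendsto (fun x => r (f x).1 (f x).2) (𝓝[≥] 0) (𝓝 0) := by
    intro f hf h0
    have hcf : Continuous fun x => ‖R' (f x).1 (f x).2‖ₑ := (hR'c.comp hf).enorm
    have h3 : Tendsto (fun x => ‖R' (f x).1 (f x).2‖ₑ) (𝓝[≥] 0) (𝓝 0) := by
      have := (hcf.tendsto 0).mono_left (nhdsWithin_le_nhds (s := Ici 0))
      simpa only [h0, clm_enorm_zero] using this
    have h4 := ENNReal.Tendsto.const_mul (a := ENNReal.ofReal (M * M)) h3
      (Or.inr ENNReal.ofReal_ne_top)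
    rw [mul_zero] at h4
    exact tendsto_of_tendsto_of_tendsto_of_le_of_le tendsto_const_nhds h4
      (fun _ => zero_le) (fun x => hrle _ _)
  have main := scalar_grr γ p T hp hγ (ENNReal.ofReal (M * M) * V ^ (1 / p))
    (ENNReal.ofReal (M * M) * N) r (fun t s => ENNReal.ofReal (M * M) ^ p * W (t, s)) hrm
    (measurable_const.mul hWm) ?_ ?_ ?_ ?_ ?_
  · refine iSup_le ?_
    rintro ⟨⟨t, s⟩, h0, hst, ht⟩
    simp only at h0 hst ht ⊢
    rcases hst.eq_or_lt with rfl | hlt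
    · simp [hR0 s ⟨h0, ht⟩]
    · have hpos : 0 < (t - s) ^ γ := Real.rpow_pos_of_pos (by linarith) _
      rw [ENNReal.ofReal_div_of_pos hpos]
      refine ENNReal.div_le_of_le_mul ?_
      rw [ofReal_norm, ← hR'e t s h0 hst ht]
      refine (hler t s).trans ((main t s h0 hlt ht).trans ?_)
      gcongr
      have hCe : ENNReal.ofReal ((34 * c + 1) * (M * M)) =
          (34 * ENNReal.ofReal c + 1) * ENNReal.ofReal (M * M) := by
        rw [ENNReal.ofReal_mul (p := 34 * c + 1) (by positivity),
          ENNReal.ofReal_add (by positivity) (by norm_num), ENNReal.ofReal_mul (by norm_num)]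
        simp only [ENNReal.ofReal_ofNat, ENNReal.ofReal_one]
      rw [hCe, ← hc]
      generalize ENNReal.ofReal c = c'
      generalize ENNReal.ofReal (M * M) = m
      generalize V ^ (1 / p) = v
      calc 2 * ((16 * (m * v) + m * N) * c') + m * N
          ≤ 2 * ((16 * (m * v) + m * N) * c') + m * N +
              (2 * c' * m * v + m * v + 32 * c' * m * N) := le_self_add
        _ = (34 * c' + 1) * m * (v + N) := by ring
  · intro t u s h0 hsu hut ht
    refine iSup_le fun ab => ?_
    obtain ⟨a, b⟩ := ab
    simp only
    rw [hR'e t s h0 (hsu.trans hut) ht]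
    set δ := R t s - (R t u).comp (S (u - s)) - (S (t - u)).comp (R u s) with hδ
    obtain ⟨a', ha'⟩ : ∃ a' : NNReal, (a' : ℝ) = u - s := ⟨⟨u - s, by linarith⟩, rfl⟩
    obtain ⟨b', hb'⟩ : ∃ b' : NNReal, (b' : ℝ) = t - u := ⟨⟨t - u, by linarith⟩, rfl⟩
    have hdec : (S a).comp ((R t s).comp (S b)) =
        (S a).comp ((R t u).comp (S ((a' + b : NNReal) : ℝ))) +
        (S ((a + b' : NNReal) : ℝ)).comp ((R u s).comp (S b)) +
        (S a).comp (δ.comp (S b)) := by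
      rw [NNReal.coe_add, NNReal.coe_add, hSadd _ _ b.coe_nonneg a'.coe_nonneg,
        hSadd _ _ b'.coe_nonneg a.coe_nonneg, ha', hb']
      ext x
      simp [hδ]
    have hδN : ‖δ‖ₑ ≤ N * ENNReal.ofReal ((t - s) ^ γ) := by
      rcases (hsu.trans hut).eq_or_lt with h | hlt
      · have hu : u = s := by linarith
        have : δ = 0 := by
          rw [hδ, ← h, hu, sub_self, hS0, hR0 s ⟨h0, by linarith⟩]
          simp
        rw [this, clm_enorm_zero]; exact zero_le
      · have hpos : 0 < (t - s) ^ γ := Real.rpow_pos_of_pos (by linarith) _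
        have h5 : ENNReal.ofReal (‖δ‖ / (t - s) ^ γ) ≤ N := by
          rw [hN]
          exact le_iSup_of_le ⟨(t, u, s), h0, hsu, hut, ht⟩ le_rfl
        rw [← ofReal_norm]
        calc ENNReal.ofReal ‖δ‖ = ENNReal.ofReal (‖δ‖ / (t - s) ^ γ * (t - s) ^ γ) := by
              rw [div_mul_cancel₀ _ hpos.ne']
          _ = ENNReal.ofReal (‖δ‖ / (t - s) ^ γ) * ENNReal.ofReal ((t - s) ^ γ) :=
              ENNReal.ofReal_mul (by positivity)
          _ ≤ _ := by gcongr
    rw [hdec]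
    refine (clm_enorm_add_le _ _).trans (add_le_add ((clm_enorm_add_le _ _).trans (add_le_add ?_ ?_)) ?_)
    · rw [← hR'e t u (by linarith) hut ht]
      exact le_iSup (fun ab : NNReal × NNReal => ‖(S ab.1).comp ((R' t u).comp (S ab.2))‖ₑ)
        (a, a' + b)
    · rw [← hR'e u s h0 hsu (by linarith)]
      exact le_iSup (fun ab : NNReal × NNReal => ‖(S ab.1).comp ((R' u s).comp (S ab.2))‖ₑ)
        (a + b', b)
    · refine (hcomp a b δ).trans ?_
      rw [mul_assoc]
      gcongr
  · intro t h0 h1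
    exact htend (fun x => (t, t - x)) (by fun_prop) (by simpa using hzero t h0 h1)
  · intro s h0 h1
    exact htend (fun x => (s + x, s)) (by fun_prop) (by simpa using hzero s h0 h1)
  · intro t s h0 hst ht
    have h5 : r t s ^ p ≤ ENNReal.ofReal (M * M) ^ p * ‖R' t s‖ₑ ^ p := by
      rw [← ENNReal.mul_rpow_of_nonneg _ _ hp0.le]
      exact ENNReal.rpow_le_rpow (hrle t s) hp0.le
    refine h5.trans ?_
    rw [mul_assoc]
    gcongr
    have hmem : (t, s) ∈ A := ⟨h0, hst, ht⟩
    rw [hW, indicator_of_mem hmem]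
    rcases hst.eq_or_lt with rfl | hlt
    · rw [hzero s h0 ht, clm_enorm_zero, ENNReal.zero_rpow_of_pos hp0]
      exact zero_le
    · have hpos : 0 < t - s := by linarith
      rw [← ENNReal.ofReal_mul (by positivity), ← ofReal_norm,
        ENNReal.ofReal_rpow_of_nonneg (norm_nonneg _) hp0.le]
      apply ENNReal.ofReal_le_ofReal
      apply le_of_eq
      have e : γ * p + 2 = (γ + 2 / p) * p := by field_simp
      rw [e, Real.rpow_mul hpos.le, ← Real.mul_rpow (by positivity) (by positivity),
        div_mul_cancel₀ _ (by positivity)]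
  · have h6 : ∫⁻ t, ∫⁻ s, ENNReal.ofReal (M * M) ^ p * W (t, s) =
        ∫⁻ q, ENNReal.ofReal (M * M) ^ p * W q :=
      (lintegral_prod (μ := volume) (ν := volume) (fun q => ENNReal.ofReal (M * M) ^ p * W q)
        (measurable_const.mul hWm).aemeasurable).symm
    rw [h6, lintegral_const_mul _ hWm, hWV, ENNReal.mul_rpow_of_nonneg _ _ hp0.le,
      ← ENNReal.rpow_mul, one_div_mul_cancel hp0.ne', ENNReal.rpow_one]
end

section
/- (Young convolution integral.) Let κ, η > 0 with κ + η > 1. Assume X^1 : 𝒮_2 → L(B) is continuous, vanishes on the diagonal, satisfies the Chen-type relation X^1_{ts} = X^1_{tu} S_{us} + S_{tu} X^1_{us} for all (t,u,s) ∈ 𝒮_3, and ‖X^1‖_κ := sup_{t>s} ‖X^1_{ts}‖_{op}/(t−s)^κ < ∞. Let z : [0,T] → B be continuous with ‖δ̂z‖_η := sup_{t>s} ‖z_t − S_{ts} z_s‖/(t−s)^η < ∞. Then there exists a unique continuous J : 𝒮_2 → B such that (a) δ̂J = 0, i.e. J_{ts} = J_{tu} + S_{tu} J_{us} for all (t,u,s)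 ∈ 𝒮_3, and (b) sup_{t>s} ‖J_{ts} − X^1_{ts} z_s‖/(t−s)^{κ+η} < ∞. Moreover ‖J‖_κ := sup_{t>s} ‖J_{ts}‖/(t−s)^κ ≤ c ‖X^1‖_κ (sup_{t∈[0,T]} ‖z_t‖ + ‖δ̂z‖_η) for a constant c depending only on κ, η, T and the semigroup bound M; and for every (t,s) ∈ 𝒮_2 with s < t, J_{ts} is the limit, as the mesh tends to zero, of the Riemann sums Σ_{i=0}^{n−1} S_{t − t_{i+1}} X^1_{t_{i+1} t_i} z_{t_i} over partitions s = t_0 < t_1 < ⋯ < t_n = t of [s,t]. -/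
open scoped BigOperators

universe u

section SewingHelpers

variable {B : Type u} [NormedAddCommGroup B] [NormedSpace ℝ B]

lemma IsSG.app {S : ℝ → B →L[ℝ] B} {M : ℝ} (hS : IsSG S M) {a b c : ℝ} (ha : 0 ≤ a) (hb : 0 ≤ b)
    (hc : c = a + b) (x : B) : S c x = S a (S b x) := by
  subst hc
  rw [hS.2.1 b a hb ha]; rfl

lemma IsSG.nrm {S : ℝ → B →L[ℝ] B} {M : ℝ} (hS : IsSG S M) {a : ℝ} (ha : 0 ≤ a) (x : B) :
    ‖S a x‖ ≤ M * ‖x‖ :=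
  (ContinuousLinearMap.le_opNorm _ _).trans
    (mul_le_mul_of_nonneg_right (hS.2.2.2 a ha) (norm_nonneg _))

lemma sum_rpow_bound {μ h : ℝ} (hμ : 1 < μ) (π : ℕ → ℝ) (n : ℕ)
    (h0 : ∀ i < n, π i ≤ π (i + 1)) (h1 : ∀ i < n, π (i + 1) - π i ≤ h) :
    ∑ i ∈ Finset.range n, (π (i + 1) - π i) ^ μ ≤ h ^ (μ - 1) * (π n - π 0) := by
  rw [← Finset.sum_range_sub, Finset.mul_sum]
  apply Finset.sum_le_sum
  intro i hi
  have hi := Finset.mem_range.1 hi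
  have hd : 0 ≤ π (i + 1) - π i := sub_nonneg.2 (h0 i hi)
  have e : (π (i + 1) - π i) ^ μ = (π (i + 1) - π i) ^ (μ - 1) * (π (i + 1) - π i) := by
    rw [← Real.rpow_add_one' hd (by linarith)]; congr 1; ring
  rw [e]
  exact mul_le_mul_of_nonneg_right (Real.rpow_le_rpow hd (h1 i hi) (by linarith)) hd

/-- Weighted Riemann sum. -/
noncomputable def RS (S : ℝ → B →L[ℝ] B) (X : ℝ → ℝ → B) (π : ℕ → ℝ) (a b : ℕ) : B :=
  ∑ i ∈ Finset.Ico a b, S (π b - π (i + 1)) (X (π (i + 1)) (π i))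

lemma RS_split {S : ℝ → B →L[ℝ] B} {M : ℝ} (hS : IsSG S M) (X : ℝ → ℝ → B) {π : ℕ → ℝ}
    (hm : Monotone π) {a b c : ℕ} (hab : a ≤ b) (hbc : b ≤ c) :
    RS S X π a c = S (π c - π b) (RS S X π a b) + RS S X π b c := by
  unfold RS
  rw [← Finset.sum_Ico_consecutive _ hab hbc, map_sum]
  congr 1
  apply Finset.sum_congr rfl
  intro i hi
  have hi := Finset.mem_Ico.1 hi
  apply hS.app (sub_nonneg.2 (hm hbc)) (sub_nonneg.2 (hm (by omega))) (by ring)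

lemma RS_one {S : ℝ → B →L[ℝ] B} {M : ℝ} (hS : IsSG S M) (X : ℝ → ℝ → B) (π : ℕ → ℝ) (a : ℕ) :
    RS S X π a (a+1) = X (π (a + 1)) (π a) := by
  unfold RS
  simp [hS.1]

/-- Bound on the twisted increment. -/
def DB (S : ℝ → B →L[ℝ] B) (X : ℝ → ℝ → B) (T μ C : ℝ) : Prop :=
  ∀ t u s : ℝ, 0 ≤ s → s ≤ u → u ≤ t → t ≤ T →
    ‖X t s - X t u - S (t - u) (X u s)‖ ≤ C * (t - s) ^ μ

lemma maximal {S : ℝ → B →L[ℝ] B} {M T μ C : ℝ} (hS : IsSG S M) (hM : 1 ≤ M) (hμ : 1 < μ)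
    (hC : 0 ≤ C) {X : ℝ → ℝ → B} (hX0 : ∀ t, 0 ≤ t → t ≤ T → X t t = 0) (hX : DB S X T μ C)
    {π : ℕ → ℝ} (hm : Monotone π) (hπ0 : ∀ i, 0 ≤ π i) (hπT : ∀ i, π i ≤ T) (n : ℕ) :
    ∀ a b : ℕ, a ≤ b → b - a ≤ n → ∀ r : ℝ, 0 ≤ r →
      ‖S r (RS S X π a b - X (π b) (π a))‖ ≤
        2 * M / (1 - 2 ^ (1 - μ)) * C * (π b - π a) ^ μ := by
  have hq : (2:ℝ) ^ (1 - μ) < 1 := Real.rpow_lt_one_of_one_lt_of_neg (by norm_num) (by linarith)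
  set K := 2 * M / (1 - 2 ^ (1 - μ)) * C with hK
  have hK0 : 0 ≤ K := by
    have : (0:ℝ) < 1 - 2 ^ (1 - μ) := by linarith
    rw [hK]; positivity
  have hKe : K * 2 ^ (1 - μ) + 2 * M * C = K := by
    have : (1:ℝ) - 2 ^ (1 - μ) ≠ 0 := by linarith
    rw [hK]; field_simp; ring
  induction n with
  | zero =>
    intro a b hab hn r hr
    obtain rfl : a = b := by omega
    have : (0:ℝ) ≤ K * (π a - π a) ^ μ := by rw [sub_self, Real.zero_rpow (by linarith)]; simp
    simpa [RS, hX0 _ (hπ0 a) (hπT a)] using this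
  | succ n ih =>
    intro a b hab hn r hr
    rcases hab.eq_or_lt with rfl | hlt
    · exact ih a a le_rfl (by omega) r hr
    have hD : 0 ≤ π b - π a := sub_nonneg.2 (hm hab)
    obtain ⟨i, hai, hib, h1, h2⟩ : ∃ i, a ≤ i ∧ i < b ∧ π i ≤ (π a + π b) / 2 ∧
        (π a + π b) / 2 ≤ π (i + 1) := by
      classical
      have hex : ∃ j, a ≤ j ∧ (π a + π b) / 2 ≤ π (j + 1) :=
        ⟨b - 1, by omega, by rw [Nat.sub_add_cancel (by omega)]; linarith⟩
      refine ⟨Nat.find hex, (Nat.find_spec hex).1, ?_, ?_, (Nat.find_spec hex).2⟩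
      · have : Nat.find hex ≤ b - 1 := Nat.find_min' hex
          ⟨by omega, by rw [Nat.sub_add_cancel (by omega)]; linarith⟩
        omega
      · rcases (Nat.find_spec hex).1.eq_or_lt with h | h
        · rw [← h]; linarith
        · have := Nat.find_min hex (m := Nat.find hex - 1) (by omega)
          rw [Nat.sub_add_cancel (by omega)] at this
          by_contra hc
          exact this ⟨by omega, by linarith⟩
    have m1 := hm hai
    have m2 := hm (Nat.le_succ i)
    have m3 := hm (Nat.succ_le_of_lt hib)
    simp only [Nat.succ_eq_add_one] at m2 m3
    have e1 : RS S X π a b = S (π b - π i) (RS S X π a i) +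
        (S (π b - π (i+1)) (X (π (i+1)) (π i)) + RS S X π (i+1) b) := by
      rw [RS_split hS X hm hai hib.le, RS_split hS X hm (Nat.le_succ i) hib, RS_one hS]
    have e2 : S (π b - π i) (X (π i) (π a)) =
        S (π b - π (i+1)) (S (π (i+1) - π i) (X (π i) (π a))) :=
      hS.app (by linarith) (by linarith) (by ring) _
    have e3 : S r (RS S X π a b - X (π b) (π a)) =
        S (r + (π b - π i)) (RS S X π a i - X (π i) (π a)) +
        S r (RS S X π (i+1) b - X (π b) (π (i+1)))
        - S r (X (π b) (π a) - X (π b) (π (i+1)) - S (π b - π (i+1)) (X (π (i+1)) (π a)))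
        - S (r + (π b - π (i+1))) (X (π (i+1)) (π a) - X (π (i+1)) (π i)
            - S (π (i+1) - π i) (X (π i) (π a))) := by
      rw [hS.app hr (by linarith) rfl, hS.app (b := π b - π (i+1)) hr (by linarith) rfl, e1]
      simp only [map_sub, map_add, e2]
      abel
    have b1 := ih a i hai (by omega) (r + (π b - π i)) (by linarith)
    have b2 := ih (i+1) b hib (by omega) r hr
    have b3 := (hS.nrm hr _).trans (mul_le_mul_of_nonneg_left
      (hX (π b) (π (i+1)) (π a) (hπ0 _) (by linarith) m3 (hπT _)) (by linarith : 0 ≤ M))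
    have b4 := (hS.nrm (by linarith : 0 ≤ r + (π b - π (i+1))) _).trans (mul_le_mul_of_nonneg_left
      (hX (π (i+1)) (π i) (π a) (hπ0 _) (by linarith) m2 (hπT _)) (by linarith : 0 ≤ M))
    have hh : ((π b - π a) / 2) ^ μ = (π b - π a) ^ μ * (2 ^ (1 - μ) / 2) := by
      rw [Real.div_rpow hD (by norm_num), Real.rpow_sub (by norm_num), Real.rpow_one]
      field_simp
    have c1 : (π i - π a) ^ μ ≤ (π b - π a) ^ μ * (2 ^ (1 - μ) / 2) :=
      hh ▸ Real.rpow_le_rpow (by linarith) (by linarith) (by linarith)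
    have c2 : (π b - π (i+1)) ^ μ ≤ (π b - π a) ^ μ * (2 ^ (1 - μ) / 2) :=
      hh ▸ Real.rpow_le_rpow (by linarith) (by linarith) (by linarith)
    have c4 : (π (i+1) - π a) ^ μ ≤ (π b - π a) ^ μ :=
      Real.rpow_le_rpow (by linarith) (by linarith) (by linarith)
    have d1 := mul_le_mul_of_nonneg_left c1 hK0
    have d2 := mul_le_mul_of_nonneg_left c2 hK0
    have d4 := mul_le_mul_of_nonneg_left c4 (by positivity : 0 ≤ M * C)
    rw [e3]
    refine (norm_sub_le _ _).trans ?_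
    have f1 := (norm_sub_le (S (r + (π b - π i)) (RS S X π a i - X (π i) (π a)) +
        S r (RS S X π (i+1) b - X (π b) (π (i+1))))
        (S r (X (π b) (π a) - X (π b) (π (i+1)) - S (π b - π (i+1)) (X (π (i+1)) (π a)))))
    have f2 := norm_add_le (S (r + (π b - π i)) (RS S X π a i - X (π i) (π a)))
        (S r (RS S X π (i+1) b - X (π b) (π (i+1))))
    have : K * (π b - π a) ^ μ = (K * 2 ^ (1 - μ) + 2 * M * C) * (π b - π a) ^ μ := by rw [hKe]
    rw [this]
    linarith

lemma sum_range_two_mul' (f : ℕ → B) (n : ℕ) :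
    ∑ j ∈ Finset.range (2 * n), f j = ∑ k ∈ Finset.range n, (f (2 * k) + f (2 * k + 1)) := by
  induction n with
  | zero => simp
  | succ n ih =>
    rw [Finset.sum_range_succ, ← ih, show 2 * (n + 1) = 2 * n + 1 + 1 by ring,
      Finset.sum_range_succ, Finset.sum_range_succ, add_assoc]

/-- Clamped dyadic grid. -/
noncomputable def grid (T t s : ℝ) (n k : ℕ) : ℝ := max s (min t (k * (T / 2 ^ n)))

lemma grid_mono {T : ℝ} (hT : 0 < T) (t s : ℝ) (n : ℕ) : Monotone (grid T t s n) := by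
  intro a b hab
  unfold grid
  have : (a : ℝ) ≤ b := by exact_mod_cast hab
  gcongr

lemma grid_zero {T t s : ℝ} (hs : 0 ≤ s) (n : ℕ) : grid T t s n 0 = s := by
  unfold grid
  rw [max_eq_left]
  refine (min_le_right _ _).trans ?_
  simpa using hs

lemma grid_last {T t s : ℝ} (hst : s ≤ t) (htT : t ≤ T) (n : ℕ) : grid T t s n (2 ^ n) = t := by
  unfold grid
  have : ((2 ^ n : ℕ) : ℝ) * (T / 2 ^ n) = T := by push_cast; field_simp
  rw [this, min_eq_left htT, max_eq_right hst]

lemma grid_step {T : ℝ} (hT : 0 < T) (t s : ℝ) (n k : ℕ) :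
    grid T t s n (k + 1) - grid T t s n k ≤ T / 2 ^ n := by
  unfold grid
  have h : 0 < T / 2 ^ n := by positivity
  push_cast
  rw [add_mul, one_mul]
  set x := (k:ℝ) * (T / 2 ^ n)
  rw [sub_le_iff_le_add]
  apply max_le
  · linarith [le_max_left s (min t x)]
  · rcases le_total t x with h1 | h1
    · have := le_max_right s (min t x)
      rw [min_eq_left h1] at *
      linarith [min_le_left t (x + T / 2 ^ n)]
    · have := le_max_right s (min t x)
      rw [min_eq_right h1] at *
      linarith [min_le_right t (x + T / 2 ^ n)]

lemma grid_succ (T t s : ℝ) (n k : ℕ) : grid T t s (n + 1) (2 * k) = grid T t s n k := by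
  unfold grid
  have : ((2 * k : ℕ) : ℝ) * (T / 2 ^ (n + 1)) = k * (T / 2 ^ n) := by
    push_cast; rw [pow_succ]; field_simp
  rw [this]

lemma grid_mem {T t s : ℝ} (hst : s ≤ t) (n k : ℕ) :
    s ≤ grid T t s n k ∧ grid T t s n k ≤ t :=
  ⟨le_max_left _ _, max_le hst (min_le_left _ _)⟩

lemma grid_max {T t s u : ℝ} (hsu : s ≤ u) (n k : ℕ) :
    grid T t u n k = max u (grid T t s n k) := by
  unfold grid
  rw [← max_assoc, max_eq_left hsu]

lemma grid_min {T t s u : ℝ} (hsu : s ≤ u) (hut : u ≤ t) (n k : ℕ) :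
    grid T u s n k = min u (grid T t s n k) := by
  unfold grid
  rw [min_max_distrib_left, min_eq_right hsu, ← min_assoc, min_eq_left hut]

/-- Grid Riemann sums. -/
noncomputable def GI (S : ℝ → B →L[ℝ] B) (X : ℝ → ℝ → B) (T t s : ℝ) (n : ℕ) : B :=
  ∑ k ∈ Finset.range (2 ^ n), S (t - grid T t s n (k + 1))
    (X (grid T t s n (k + 1)) (grid T t s n k))

lemma norm_sum_grid {S : ℝ → B →L[ℝ] B} {M T μ C : ℝ} (hM : 1 ≤ M) (hμ : 1 < μ)
    (hT : 0 < T) (hC : 0 ≤ C) {t s : ℝ} (hs : 0 ≤ s) (hst : s ≤ t) (htT : t ≤ T) (n : ℕ)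
    (f : ℕ → B) (hf : ∀ k < 2 ^ n,
      ‖f k‖ ≤ M * (C * (grid T t s n (k + 1) - grid T t s n k) ^ μ)) :
    ‖∑ k ∈ Finset.range (2 ^ n), f k‖ ≤ M * C * (t - s) * T ^ (μ - 1) * (2 ^ (1 - μ)) ^ n := by
  have h1 := sum_rpow_bound (h := T / 2 ^ n) hμ (grid T t s n) (2 ^ n)
    (fun i _ => grid_mono hT t s n (Nat.le_succ i)) (fun i _ => grid_step hT t s n i)
  rw [grid_zero hs, grid_last hst htT] at h1
  have h2 : (T / 2 ^ n) ^ (μ - 1) = T ^ (μ - 1) * (2 ^ (1 - μ)) ^ n := by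
    rw [Real.div_rpow hT.le (by positivity), ← Real.rpow_natCast, ← Real.rpow_natCast,
      ← Real.rpow_mul (by norm_num), ← Real.rpow_mul (by norm_num), div_eq_mul_inv,
      ← Real.rpow_neg (by norm_num)]
    congr 2; ring
  calc ‖∑ k ∈ Finset.range (2 ^ n), f k‖ ≤ ∑ k ∈ Finset.range (2 ^ n),
        M * (C * (grid T t s n (k + 1) - grid T t s n k) ^ μ) :=
        norm_sum_le_of_le _ (fun k hk => hf k (Finset.mem_range.1 hk))
    _ = M * C * ∑ k ∈ Finset.range (2 ^ n), (grid T t s n (k + 1) - grid T t s n k) ^ μ := by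
        rw [Finset.mul_sum]; exact Finset.sum_congr rfl (fun _ _ => by ring)
    _ ≤ M * C * ((T / 2 ^ n) ^ (μ - 1) * (t - s)) := by gcongr
    _ = _ := by rw [h2]; ring

lemma GI_cauchy {S : ℝ → B →L[ℝ] B} {M T μ C : ℝ} (hS : IsSG S M) (hM : 1 ≤ M) (hμ : 1 < μ)
    (hT : 0 < T) (hC : 0 ≤ C) {X : ℝ → ℝ → B} (hX : DB S X T μ C) {t s : ℝ} (hs : 0 ≤ s)
    (hst : s ≤ t) (htT : t ≤ T) (n : ℕ) :
    ‖GI S X T t s n - GI S X T t s (n+1)‖ ≤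
      M * C * (t - s) * T ^ (μ - 1) * (2 ^ (1 - μ)) ^ n := by
  unfold GI
  rw [pow_succ', sum_range_two_mul', ← Finset.sum_sub_distrib]
  apply norm_sum_grid (S := S) hM hμ hT hC hs hst htT
  intro k _
  rw [show 2 * k + 1 + 1 = 2 * (k + 1) by ring, grid_succ, grid_succ]
  have m1 : grid T t s n k ≤ grid T t s (n+1) (2*k+1) := by
    rw [← grid_succ T t s n k]; exact grid_mono hT t s _ (by omega)
  have m2 : grid T t s (n+1) (2*k+1) ≤ grid T t s n (k+1) := by
    rw [← grid_succ T t s n (k+1)]; exact grid_mono hT t s _ (by omega)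
  have m3 := (grid_mem (T := T) hst n (k+1)).2
  have m0 := (grid_mem (T := T) hst n k).1
  rw [hS.app (c := t - grid T t s (n+1) (2*k+1)) (a := t - grid T t s n (k+1))
    (b := grid T t s n (k+1) - grid T t s (n+1) (2*k+1)) (by linarith) (by linarith) (by ring),
    ← map_add, ← map_sub]
  refine (hS.nrm (by linarith) _).trans (mul_le_mul_of_nonneg_left ?_ (by linarith))
  have := hX _ _ _ (by linarith) m1 m2 (by linarith)
  rwa [sub_sub, add_comm (X _ _) (S _ _)] at this

lemma GI_add {S : ℝ → B →L[ℝ] B} {M T μ C : ℝ} (hS : IsSG S M) (hM : 1 ≤ M) (hμ : 1 < μ)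
    (hT : 0 < T) (hC : 0 ≤ C) {X : ℝ → ℝ → B} (hX0 : ∀ t, 0 ≤ t → t ≤ T → X t t = 0)
    (hX : DB S X T μ C) {t u s : ℝ} (hs : 0 ≤ s)
    (hsu : s ≤ u) (hut : u ≤ t) (htT : t ≤ T) (n : ℕ) :
    ‖GI S X T t s n - (GI S X T t u n + S (t - u) (GI S X T u s n))‖ ≤
      M * C * (t - s) * T ^ (μ - 1) * (2 ^ (1 - μ)) ^ n := by
  have hst := hsu.trans hut
  unfold GI
  rw [map_sum, ← Finset.sum_add_distrib, ← Finset.sum_sub_distrib]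
  apply norm_sum_grid (S := S) hM hμ hT hC hs hst htT
  intro k _
  rw [grid_max (t := t) hsu, grid_max (t := t) hsu, grid_min hsu hut, grid_min hsu hut]
  have m1 : grid T t s n k ≤ grid T t s n (k+1) := grid_mono hT t s _ (by omega)
  have m3 := (grid_mem (T := T) hst n (k+1)).2
  have m0 := (grid_mem (T := T) hst n k).1
  set p := grid T t s n k
  set q := grid T t s n (k+1)
  have hR : 0 ≤ M * (C * (q - p) ^ μ) := by
    have : 0 ≤ q - p := by linarith
    positivity
  have hu := hX0 u (by linarith) (by linarith)
  rcases le_total u p with h1 | h1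
  · rw [max_eq_right h1, max_eq_right (h1.trans m1), min_eq_left h1, min_eq_left (h1.trans m1), hu]
    simpa using hR
  rcases le_total q u with h2 | h2
  · rw [max_eq_left h1, max_eq_left h2, min_eq_right h1, min_eq_right h2, hu,
      ← hS.app (c := t - q) (by linarith) (by linarith) (by ring)]
    simpa using hR
  · rw [max_eq_left h1, max_eq_right h2, min_eq_right h1, min_eq_left h2, sub_self u, hS.1,
      hS.app (c := t - u) (a := t - q) (b := q - u) (by linarith) (by linarith) (by ring)]
    simp only [ContinuousLinearMap.id_apply]
    rw [← map_add, ← map_sub]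
    refine (hS.nrm (by linarith) _).trans (mul_le_mul_of_nonneg_left ?_ (by linarith))
    have := hX q u p (by linarith) h1 h2 (by linarith)
    rwa [sub_sub] at this

lemma sewing [CompleteSpace B] {S : ℝ → B →L[ℝ] B} {M T μ C₀ : ℝ} (hS : IsSG S M) (hM : 1 ≤ M)
    (hμ : 1 < μ) (hT : 0 < T) (hC₀ : 0 ≤ C₀) {X : ℝ → ℝ → B}
    (hX0 : ∀ t, 0 ≤ t → t ≤ T → X t t = 0) (hX₀ : DB S X T μ C₀) :
    ∃ J : ℝ → ℝ → B, (∀ t u s : ℝ, 0 ≤ s → s ≤ u → u ≤ t → t ≤ T →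
            J t s = J t u + S (t - u) (J u s)) ∧
      ∀ C, 0 ≤ C → DB S X T μ C → ∀ t s : ℝ, 0 ≤ s → s ≤ t → t ≤ T →
        ‖J t s - X t s‖ ≤ 2 * M / (1 - 2 ^ (1 - μ)) * C * (t - s) ^ μ := by
  have hq : (2:ℝ) ^ (1 - μ) < 1 := Real.rpow_lt_one_of_one_lt_of_neg (by norm_num) (by linarith)
  have hlim : ∀ t s : ℝ, ∃ y : B, 0 ≤ s → s ≤ t → t ≤ T →
      Filter.Tendsto (GI S X T t s) Filter.atTop (nhds y) := by
    intro t s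
    by_cases h : 0 ≤ s ∧ s ≤ t ∧ t ≤ T
    · have hc : CauchySeq (GI S X T t s) :=
        cauchySeq_of_le_geometric _ _ hq (fun n => by
          rw [dist_eq_norm]; exact GI_cauchy hS hM hμ hT hC₀ hX₀ h.1 h.2.1 h.2.2 n)
      obtain ⟨y, hy⟩ := cauchySeq_tendsto_of_complete hc
      exact ⟨y, fun _ _ _ => hy⟩
    · exact ⟨0, fun a b c => (h ⟨a, b, c⟩).elim⟩
  choose J hJ using hlim
  refine ⟨J, ?_, ?_⟩
  · intro t u s hs hsu hut htT
    have h1 := (hJ t s hs (hsu.trans hut) htT).sub ((hJ t u (hs.trans hsu) hut htT).add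
      (((S (t - u)).continuous.tendsto _).comp (hJ u s hs hsu (hut.trans htT))))
    have h2 : Filter.Tendsto (fun n : ℕ => M * C₀ * (t - s) * T ^ (μ - 1) * (2 ^ (1 - μ)) ^ n)
        Filter.atTop (nhds 0) := by
      simpa using (tendsto_pow_atTop_nhds_zero_of_lt_one (by positivity) hq).const_mul
        (M * C₀ * (t - s) * T ^ (μ - 1))
    have h3 := squeeze_zero_norm (fun n => GI_add hS hM hμ hT hC₀ hX0 hX₀ hs hsu hut htT n) h2
    exact sub_eq_zero.1 (tendsto_nhds_unique h1 h3)
  · intro C hC hX t s hs hst htT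
    have h1 := ((hJ t s hs hst htT).sub_const (X t s)).norm
    refine le_of_tendsto h1 (Filter.Eventually.of_forall fun n => ?_)
    have := maximal hS hM hμ hC hX0 hX (grid_mono hT t s n)
      (fun i => hs.trans (grid_mem hst n i).1) (fun i => (grid_mem hst n i).2.trans htT) (2^n)
      0 (2^n) (Nat.zero_le _) (Nat.sub_le _ _) 0 le_rfl
    rw [grid_zero hs, grid_last hst htT, hS.1] at this
    unfold RS at this
    rw [grid_last hst htT] at this
    simpa [GI] using this

lemma J_diag {S : ℝ → B →L[ℝ] B} {M T : ℝ} (hS : IsSG S M) {J : ℝ → ℝ → B}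
    (hJ : ∀ t u s : ℝ, 0 ≤ s → s ≤ u → u ≤ t → t ≤ T → J t s = J t u + S (t - u) (J u s))
    {t : ℝ} (h0 : 0 ≤ t) (hT : t ≤ T) : J t t = 0 := by
  have := hJ t t t h0 le_rfl le_rfl hT
  simpa [hS.1] using this

lemma riemann_bound {S : ℝ → B →L[ℝ] B} {M T μ K h : ℝ} (hS : IsSG S M) (hM : 1 ≤ M)
    (hμ : 1 < μ) (hK : 0 ≤ K) {J X : ℝ → ℝ → B}
    (hJ : ∀ t u s : ℝ, 0 ≤ s → s ≤ u → u ≤ t → t ≤ T → J t s = J t u + S (t - u) (J u s))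
    (hJX : ∀ t s : ℝ, 0 ≤ s → s ≤ t → t ≤ T → ‖J t s - X t s‖ ≤ K * (t - s) ^ μ)
    {t s : ℝ} (hs : 0 ≤ s) (htT : t ≤ T) (n : ℕ) (π : ℕ → ℝ) (h0 : π 0 = s)
    (hn : π n = t) (hm : ∀ i < n, π i < π (i+1)) (hh : ∀ i < n, π (i + 1) - π i ≤ h) :
    ‖(∑ i ∈ Finset.range n, S (t - π (i + 1)) (X (π (i + 1)) (π i))) - J t s‖ ≤
      M * K * (h ^ (μ - 1) * (t - s)) := by
  have mono : ∀ i j, i ≤ j → j ≤ n → π i ≤ π j := by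
    intro i j hij
    induction j, hij using Nat.le_induction with
    | base => intro _; exact le_rfl
    | succ j _ ih => intro hj; exact (ih (by omega)).trans (hm j (by omega)).le
  have key : ∀ m ≤ n, J (π m) s = ∑ i ∈ Finset.range m,
      S (π m - π (i + 1)) (J (π (i + 1)) (π i)) := by
    intro m
    induction m with
    | zero =>
      intro _
      rw [h0]; simp
      have := mono 0 n (by omega) le_rfl
      exact J_diag hS hJ hs (by linarith)
    | succ m ih =>
      intro hmn
      have a1 := mono 0 m (by omega) (by omega)
      have a2 := hm m (by omega)
      have a3 := mono (m+1) n hmn le_rfl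
      rw [hJ (π (m+1)) (π m) s hs (by linarith) (by linarith) (by linarith), ih (by omega),
        Finset.sum_range_succ, map_sum, sub_self, hS.1, add_comm]
      congr 1
      apply Finset.sum_congr rfl
      intro i hi
      have hi := Finset.mem_range.1 hi
      have := mono (i+1) m (by omega) (by omega)
      exact (hS.app (by linarith) (by linarith) (by ring) _).symm
  have k := key n le_rfl
  rw [hn] at k
  rw [k, ← Finset.sum_sub_distrib]
  have sb := sum_rpow_bound hμ π n (fun i hi => (hm i hi).le) hh
  rw [h0, hn] at sb
  calc _ ≤ ∑ i ∈ Finset.range n, M * (K * (π (i+1) - π i) ^ μ) := by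
        apply norm_sum_le_of_le
        intro i hi
        have hi := Finset.mem_range.1 hi
        have a1 := mono 0 i (by omega) (by omega)
        have a2 := hm i (by omega)
        have a3 := mono (i+1) n hi le_rfl
        rw [← map_sub]
        refine (hS.nrm (by linarith) _).trans (mul_le_mul_of_nonneg_left ?_ (by linarith))
        rw [norm_sub_rev]
        exact hJX _ _ (by linarith) (by linarith) (by linarith)
    _ = M * K * ∑ i ∈ Finset.range n, (π (i+1) - π i) ^ μ := by
        rw [Finset.mul_sum]; exact Finset.sum_congr rfl (fun _ _ => by ring)
    _ ≤ _ := by gcongr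

lemma riemann_limit {S : ℝ → B →L[ℝ] B} {M T μ K : ℝ} (hS : IsSG S M) (hM : 1 ≤ M)
    (hμ : 1 < μ) (hK : 0 ≤ K) {J X : ℝ → ℝ → B}
    (hJ : ∀ t u s : ℝ, 0 ≤ s → s ≤ u → u ≤ t → t ≤ T → J t s = J t u + S (t - u) (J u s))
    (hJX : ∀ t s : ℝ, 0 ≤ s → s ≤ t → t ≤ T → ‖J t s - X t s‖ ≤ K * (t - s) ^ μ)
    {t s : ℝ} (hs : 0 ≤ s) (htT : t ≤ T) (ε : ℝ) (hε : 0 < ε) :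
    ∃ δ : ℝ, 0 < δ ∧
          ∀ (n : ℕ) (π : ℕ → ℝ), π 0 = s → π n = t →
            (∀ i < n, π i < π (i + 1)) → (∀ i < n, π (i + 1) - π i < δ) →
            ‖(∑ i ∈ Finset.range n,
                S (t - π (i + 1)) (X (π (i + 1)) (π i))) - J t s‖ < ε := by
  have h1 : Filter.Tendsto (fun h : ℝ => M * K * (h ^ (μ - 1) * (t - s))) (nhds 0) (nhds 0) := by
    have : ContinuousAt (fun h : ℝ => M * K * (h ^ (μ - 1) * (t - s))) 0 := by
      have := Real.continuousAt_rpow_const 0 (μ - 1) (Or.inr (by linarith))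
      fun_prop
    have h := this.tendsto
    simpa [Real.zero_rpow (by linarith : μ - 1 ≠ 0)] using h
  obtain ⟨δ, hδ, h⟩ := Metric.eventually_nhds_iff.1 (h1.eventually (gt_mem_nhds hε))
  refine ⟨δ / 2, by positivity, fun n π a b c d => ?_⟩
  refine (riemann_bound hS hM hμ hK hJ hJX hs htT n π a b c (fun i hi => (d i hi).le)).trans_lt ?_
  apply h
  rw [Real.dist_eq, sub_zero, abs_of_pos (by positivity)]
  linarith

lemma J_unique {S : ℝ → B →L[ℝ] B} {M T μ K K' : ℝ} (hS : IsSG S M) (hM : 1 ≤ M)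
    (hμ : 1 < μ) (hK : 0 ≤ K) (hK' : 0 ≤ K') {J J' X : ℝ → ℝ → B}
    (hJ : ∀ t u s : ℝ, 0 ≤ s → s ≤ u → u ≤ t → t ≤ T → J t s = J t u + S (t - u) (J u s))
    (hJX : ∀ t s : ℝ, 0 ≤ s → s ≤ t → t ≤ T → ‖J t s - X t s‖ ≤ K * (t - s) ^ μ)
    (hJ' : ∀ t u s : ℝ, 0 ≤ s → s ≤ u → u ≤ t → t ≤ T → J' t s = J' t u + S (t - u) (J' u s))
    (hJX' : ∀ t s : ℝ, 0 ≤ s → s ≤ t → t ≤ T → ‖J' t s - X t s‖ ≤ K' * (t - s) ^ μ)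
    {t s : ℝ} (hs : 0 ≤ s) (hst : s ≤ t) (htT : t ≤ T) : J' t s = J t s := by
  rcases hst.eq_or_lt with rfl | hlt
  · rw [J_diag hS hJ hs htT, J_diag hS hJ' hs htT]
  rw [← sub_eq_zero, ← norm_le_zero_iff]
  refine le_of_forall_pos_lt_add fun ε hε => ?_
  obtain ⟨δ, hδ, h⟩ := riemann_limit hS hM hμ hK hJ hJX hs htT (ε/2) (by positivity)
  obtain ⟨δ', hδ', h'⟩ := riemann_limit hS hM hμ hK' hJ' hJX' hs htT (ε/2) (by positivity)
  obtain ⟨n, hn⟩ := exists_nat_gt ((t - s) / min δ δ')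
  have hmin : 0 < min δ δ' := lt_min hδ hδ'
  have hts : 0 < t - s := by linarith
  have hn0 : (0:ℝ) < n := lt_trans (by positivity) hn
  have hst : (t - s) / n < min δ δ' := by
    rw [div_lt_iff₀ hmin] at hn
    rw [div_lt_iff₀ hn0]; linarith
  have hpos : 0 < (t - s) / n := by positivity
  have st : ∀ i : ℕ, (s + ((i + 1 : ℕ) : ℝ) * ((t - s) / n)) - (s + (i : ℝ) * ((t - s) / n))
      = (t - s) / n := by intro i; push_cast; ring
  have a := h n (fun i => s + i * ((t - s) / n)) (by simp) (by field_simp; ring)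
    (fun i _ => by have := st i; linarith)
    (fun i _ => by have := st i; linarith [min_le_left δ δ'])
  have b := h' n (fun i => s + i * ((t - s) / n)) (by simp) (by field_simp; ring)
    (fun i _ => by have := st i; linarith)
    (fun i _ => by have := st i; linarith [min_le_right δ δ'])
  rw [← dist_eq_norm] at a b ⊢
  have := dist_triangle_left (J' t s) (J t s) (∑ i ∈ Finset.range n,
    S (t - (s + ((i + 1 : ℕ) : ℝ) * ((t - s) / n))) (X (s + ((i + 1 : ℕ) : ℝ) * ((t - s) / n))
      (s + (i : ℝ) * ((t - s) / n))))
  linarith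

lemma SG_joint {S : ℝ → B →L[ℝ] B} {M : ℝ} (hS : IsSG S M) {α : Type*} [TopologicalSpace α]
    {A : Set α} {f : α → ℝ} {g : α → B} (hf : ContinuousOn f A) (hf0 : ∀ a ∈ A, 0 ≤ f a)
    (hg : ContinuousOn g A) : ContinuousOn (fun a => S (f a) (g a)) A := by
  intro a ha
  have h1 : ContinuousWithinAt (fun x => S (f x) (g a)) A a :=
    ((hS.2.2.1 (g a)).comp hf (fun x hx => hf0 x hx)) a ha
  have h2 : Filter.Tendsto (fun x => S (f x) (g x) - S (f x) (g a)) (nhdsWithin a A) (nhds 0) := by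
    have h3 : Filter.Tendsto (fun x => M * ‖g x - g a‖) (nhdsWithin a A) (nhds 0) := by
      have := ((hg a ha).tendsto.sub_const (g a)).norm.const_mul M
      simpa using this
    refine squeeze_zero_norm' ?_ h3
    filter_upwards [self_mem_nhdsWithin] with x hx
    rw [← map_sub]
    exact hS.nrm (hf0 x hx) _
  have := h2.add h1
  simpa [ContinuousWithinAt] using this

lemma J_cont {S : ℝ → B →L[ℝ] B} {M T κ K : ℝ} (hS : IsSG S M) (hκ : 0 < κ)
    {J : ℝ → ℝ → B} (hK : 0 ≤ K)
    (hJ : ∀ t u s : ℝ, 0 ≤ s → s ≤ u → u ≤ t → t ≤ T → J t s = J t u + S (t - u) (J u s))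
    (hJK : ∀ t s : ℝ, 0 ≤ s → s ≤ t → t ≤ T → ‖J t s‖ ≤ K * (t - s) ^ κ) :
    ContinuousOn (fun q : ℝ × ℝ => J q.1 q.2)
            {q : ℝ × ℝ | 0 ≤ q.2 ∧ q.2 ≤ q.1 ∧ q.1 ≤ T} := by
  have hF : ContinuousOn (fun t => J t 0) (Set.Icc 0 T) := by
    intro t₀ ht₀
    apply Metric.continuousWithinAt_iff'.2
    intro ε hε
    have hc : Filter.Tendsto (fun h : ℝ => K * h ^ κ) (nhds 0) (nhds 0) := by
      have : ContinuousAt (fun h : ℝ => K * h ^ κ) 0 := by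
        have := Real.continuousAt_rpow_const 0 κ (Or.inr hκ.le)
        fun_prop
      have h := this.tendsto
      simpa [Real.zero_rpow hκ.ne'] using h
    obtain ⟨δ, hδ, hd⟩ := Metric.eventually_nhds_iff.1
      (hc.eventually (gt_mem_nhds (by positivity : 0 < ε / 3)))
    have hd : ∀ h, 0 ≤ h → h < δ → K * h ^ κ < ε / 3 := fun h h0 h1 => hd (by
      rwa [Real.dist_eq, sub_zero, abs_of_nonneg h0])
    set u := max 0 (t₀ - δ / 2) with hu
    have hu0 : 0 ≤ u := le_max_left _ _
    have hut : u ≤ t₀ := max_le ht₀.1 (by linarith)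
    have hud : t₀ - u ≤ δ / 2 := by linarith [le_max_right 0 (t₀ - δ / 2)]
    have hnb : ∀ᶠ t in nhdsWithin t₀ (Set.Icc 0 T), u ≤ t := by
      rcases ht₀.1.eq_or_lt with h | h
      · have : u = 0 := by rw [hu]; apply max_eq_left; linarith
        filter_upwards [self_mem_nhdsWithin] with t ht
        rw [this]; exact ht.1
      · have : u < t₀ := max_lt h (by linarith)
        exact mem_nhdsWithin_of_mem_nhds (Ici_mem_nhds this)
    have hnb2 : ∀ᶠ t in nhdsWithin t₀ (Set.Icc 0 T), t < t₀ + δ / 2 :=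
      mem_nhdsWithin_of_mem_nhds (Iio_mem_nhds (by linarith))
    have hSc : ContinuousOn (fun t => S (t - u) (J u 0)) (Set.Icc u T) :=
      SG_joint hS (by fun_prop) (fun a ha => by linarith [ha.1]) continuousOn_const
    obtain ⟨δ', hδ', h'⟩ := Metric.continuousOn_iff.1 hSc t₀ ⟨hut, ht₀.2⟩ (ε / 3) (by positivity)
    have hnb3 : ∀ᶠ t in nhdsWithin t₀ (Set.Icc 0 T), dist t t₀ < δ' :=
      mem_nhdsWithin_of_mem_nhds (Metric.ball_mem_nhds _ hδ')
    filter_upwards [hnb, hnb2, hnb3, self_mem_nhdsWithin] with t h1 h2 h3 h4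
    have a1 := (hJK t u hu0 h1 h4.2).trans_lt (hd _ (by linarith) (by linarith))
    have a2 := (hJK t₀ u hu0 hut ht₀.2).trans_lt (hd _ (by linarith) (by linarith))
    have a3 := h' t ⟨h1, h4.2⟩ h3
    rw [hJ t u 0 le_rfl hu0 h1 h4.2, hJ t₀ u 0 le_rfl hu0 hut ht₀.2]
    refine (dist_add_add_le _ _ _ _).trans_lt ?_
    have := norm_sub_le (J t u) (J t₀ u)
    rw [dist_eq_norm (J t u)]
    linarith
  have h1 : ContinuousOn (fun q : ℝ × ℝ => J q.1 0 - S (q.1 - q.2) (J q.2 0))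
      {q : ℝ × ℝ | 0 ≤ q.2 ∧ q.2 ≤ q.1 ∧ q.1 ≤ T} := by
    apply ContinuousOn.sub
    · exact hF.comp continuous_fst.continuousOn (fun q hq => ⟨hq.1.trans hq.2.1, hq.2.2⟩)
    · apply SG_joint hS (by fun_prop) (fun q hq => by linarith [hq.2.1])
      exact hF.comp continuous_snd.continuousOn (fun q hq => ⟨hq.1, hq.2.1.trans hq.2.2⟩)
  refine h1.congr fun q hq => ?_
  show J q.1 q.2 = J q.1 0 - S (q.1 - q.2) (J q.2 0)
  rw [hJ q.1 q.2 0 le_rfl hq.1 hq.2.1 hq.2.2]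
  abel

end SewingHelpers

/-- The Young convolution integral `J = 𝒥(d̂x z)`: given `X¹ ∈ Ĉ₂^κ 𝓛(B)` with
`δ̃X¹ = 0` and `z` with `‖δ̂z‖_η < ∞`, `κ + η > 1`, there is a unique continuous `J`
with `δ̂J = 0` and `J − X¹ z ∈ Ĉ₂^{κ+η}`; it satisfies
`‖J‖_κ ≤ c ‖X¹‖_κ (‖z‖_∞ + ‖δ̂z‖_η)` and is the limit of the weighted Riemann sums
`Σ S_{t−t_{i+1}} X¹_{t_{i+1}t_i} z_{t_i}`. -/
theorem stmt12 (κ η T M : ℝ) (hκ : 0 < κ) (hη : 0 < η) (hκη : 1 < κ + η)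
    (hT : 0 < T) (hM : 1 ≤ M) :
    ∃ c : ℝ, 0 < c ∧
      ∀ (B : Type u) [NormedAddCommGroup B] [NormedSpace ℝ B] [CompleteSpace B],
      ∀ S : ℝ → B →L[ℝ] B, IsSG S M →
      ∀ X1 : ℝ → ℝ → B →L[ℝ] B,
        ContinuousOn (fun q : ℝ × ℝ => X1 q.1 q.2)
          {q : ℝ × ℝ | 0 ≤ q.2 ∧ q.2 ≤ q.1 ∧ q.1 ≤ T} →
        (∀ t ∈ Set.Icc (0 : ℝ) T, X1 t t = 0) →
        (∀ t u s : ℝ, 0 ≤ s → s ≤ u → u ≤ t → t ≤ T →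
          X1 t s = (X1 t u).comp (S (u - s)) + (S (t - u)).comp (X1 u s)) →
        (∃ K1 : ℝ, 0 ≤ K1 ∧ ∀ t s : ℝ, 0 ≤ s → s ≤ t → t ≤ T →
          ‖X1 t s‖ ≤ K1 * (t - s) ^ κ) →
      ∀ z : ℝ → B, ContinuousOn z (Set.Icc 0 T) →
        (∃ Kz : ℝ, 0 ≤ Kz ∧ ∀ t s : ℝ, 0 ≤ s → s ≤ t → t ≤ T →
          ‖z t - S (t - s) (z s)‖ ≤ Kz * (t - s) ^ η) →
      ∃ J : ℝ → ℝ → B,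
        (ContinuousOn (fun q : ℝ × ℝ => J q.1 q.2)
            {q : ℝ × ℝ | 0 ≤ q.2 ∧ q.2 ≤ q.1 ∧ q.1 ≤ T} ∧
          (∀ t u s : ℝ, 0 ≤ s → s ≤ u → u ≤ t → t ≤ T →
            J t s = J t u + S (t - u) (J u s)) ∧
          (∃ K : ℝ, 0 ≤ K ∧ ∀ t s : ℝ, 0 ≤ s → s ≤ t → t ≤ T →
            ‖J t s - X1 t s (z s)‖ ≤ K * (t - s) ^ (κ + η))) ∧
        (∀ J' : ℝ → ℝ → B,
          (ContinuousOn (fun q : ℝ × ℝ => J' q.1 q.2)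
              {q : ℝ × ℝ | 0 ≤ q.2 ∧ q.2 ≤ q.1 ∧ q.1 ≤ T} ∧
            (∀ t u s : ℝ, 0 ≤ s → s ≤ u → u ≤ t → t ≤ T →
              J' t s = J' t u + S (t - u) (J' u s)) ∧
            (∃ K : ℝ, 0 ≤ K ∧ ∀ t s : ℝ, 0 ≤ s → s ≤ t → t ≤ T →
              ‖J' t s - X1 t s (z s)‖ ≤ K * (t - s) ^ (κ + η))) →
          ∀ t s : ℝ, 0 ≤ s → s ≤ t → t ≤ T → J' t s = J t s) ∧
        (∀ K1 Kz0 Kz : ℝ, 0 ≤ K1 → 0 ≤ Kz0 → 0 ≤ Kz →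
          (∀ t s : ℝ, 0 ≤ s → s ≤ t → t ≤ T → ‖X1 t s‖ ≤ K1 * (t - s) ^ κ) →
          (∀ t ∈ Set.Icc (0 : ℝ) T, ‖z t‖ ≤ Kz0) →
          (∀ t s : ℝ, 0 ≤ s → s ≤ t → t ≤ T →
            ‖z t - S (t - s) (z s)‖ ≤ Kz * (t - s) ^ η) →
          ∀ t s : ℝ, 0 ≤ s → s ≤ t → t ≤ T →
            ‖J t s‖ ≤ c * K1 * (Kz0 + Kz) * (t - s) ^ κ) ∧
        ∀ t s : ℝ, 0 ≤ s → s < t → t ≤ T → ∀ ε : ℝ, 0 < ε → ∃ δ : ℝ, 0 < δ ∧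
          ∀ (n : ℕ) (π : ℕ → ℝ), π 0 = s → π n = t →
            (∀ i < n, π i < π (i + 1)) → (∀ i < n, π (i + 1) - π i < δ) →
            ‖(∑ i ∈ Finset.range n,
                S (t - π (i + 1)) (X1 (π (i + 1)) (π i) (z (π i)))) - J t s‖ < ε := by
  have hq : (2:ℝ) ^ (1 - (κ + η)) < 1 :=
    Real.rpow_lt_one_of_one_lt_of_neg (by norm_num) (by linarith)
  have hq' : 0 < 1 - (2:ℝ) ^ (1 - (κ + η)) := by linarith
  set c₀ := 2 * M / (1 - (2:ℝ) ^ (1 - (κ + η))) with hc₀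
  have hc0 : 0 < c₀ := by positivity
  refine ⟨c₀ * T ^ η + 1, by positivity, ?_⟩
  intro B _ _ _ S hS X1 hX1c hX1d hX1 ⟨K1, hK1, hXK⟩ z hz ⟨Kz, hKz, hzK⟩
  have hX0 : ∀ t, 0 ≤ t → t ≤ T → (fun t s => X1 t s (z s)) t t = 0 := by
    intro t h0 h1
    simp [hX1d t ⟨h0, h1⟩]
  have hDB : ∀ K1 Kz : ℝ, 0 ≤ K1 → 0 ≤ Kz →
      (∀ t s : ℝ, 0 ≤ s → s ≤ t → t ≤ T → ‖X1 t s‖ ≤ K1 * (t - s) ^ κ) →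
      (∀ t s : ℝ, 0 ≤ s → s ≤ t → t ≤ T → ‖z t - S (t - s) (z s)‖ ≤ Kz * (t - s) ^ η) →
      DB S (fun t s => X1 t s (z s)) T (κ + η) (K1 * Kz) := by
    intro K1 Kz hK1 hKz hXK hzK t u s hs hsu hut htT
    have e : X1 t s (z s) - X1 t u (z u) - S (t - u) (X1 u s (z s)) =
        - X1 t u (z u - S (u - s) (z s)) := by
      rw [hX1 t u s hs hsu hut htT]
      simp
      abel
    show ‖X1 t s (z s) - X1 t u (z u) - S (t - u) (X1 u s (z s))‖ ≤ _
    rw [e, norm_neg]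
    have p0 : 0 ≤ t - s := by linarith
    have p1 : 0 ≤ t - u := by linarith
    have p2 : 0 ≤ u - s := by linarith
    calc _ ≤ ‖X1 t u‖ * ‖z u - S (u - s) (z s)‖ := ContinuousLinearMap.le_opNorm _ _
      _ ≤ (K1 * (t - u) ^ κ) * (Kz * (u - s) ^ η) := by
        gcongr
        · exact hXK _ _ (by linarith) hut htT
        · exact hzK _ _ hs hsu (by linarith)
      _ ≤ (K1 * (t - s) ^ κ) * (Kz * (t - s) ^ η) := by gcongr
      _ = _ := by rw [Real.rpow_add_of_nonneg p0 hκ.le hη.le]; ring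
  obtain ⟨J, hJ, hJb⟩ := sewing hS hM hκη hT (mul_nonneg hK1 hKz) hX0
    (hDB K1 Kz hK1 hKz hXK hzK)
  have hJK := hJb _ (mul_nonneg hK1 hKz) (hDB K1 Kz hK1 hKz hXK hzK)
  rw [← hc₀] at hJK
  have hKK : 0 ≤ c₀ * (K1 * Kz) := by positivity
  have hbd : ∀ K1 Kz0 Kz : ℝ, 0 ≤ K1 → 0 ≤ Kz0 → 0 ≤ Kz →
          (∀ t s : ℝ, 0 ≤ s → s ≤ t → t ≤ T → ‖X1 t s‖ ≤ K1 * (t - s) ^ κ) →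
          (∀ t ∈ Set.Icc (0 : ℝ) T, ‖z t‖ ≤ Kz0) →
          (∀ t s : ℝ, 0 ≤ s → s ≤ t → t ≤ T →
            ‖z t - S (t - s) (z s)‖ ≤ Kz * (t - s) ^ η) →
          ∀ t s : ℝ, 0 ≤ s → s ≤ t → t ≤ T →
            ‖J t s‖ ≤ (c₀ * T ^ η + 1) * K1 * (Kz0 + Kz) * (t - s) ^ κ := by
    intro K1 Kz0 Kz hK1 hKz0 hKz hXK hz0 hzK t s hs hst htT
    have a1 := hJb _ (mul_nonneg hK1 hKz) (hDB K1 Kz hK1 hKz hXK hzK) t s hs hst htT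
    rw [← hc₀] at a1
    have p0 : 0 ≤ t - s := by linarith
    have a2 : ‖X1 t s (z s)‖ ≤ (K1 * (t - s) ^ κ) * Kz0 :=
      (ContinuousLinearMap.le_opNorm _ _).trans (mul_le_mul (hXK t s hs hst htT)
        (hz0 s ⟨hs, by linarith⟩) (norm_nonneg _) (by positivity))
    have a3 : (t - s) ^ (κ + η) ≤ (t - s) ^ κ * T ^ η := by
      rw [Real.rpow_add_of_nonneg p0 hκ.le hη.le]
      gcongr
      linarith
    have a4 := mul_le_mul_of_nonneg_left a3 (by positivity : 0 ≤ c₀ * (K1 * Kz))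
    have a5 : ‖J t s‖ ≤ ‖J t s - X1 t s (z s)‖ + ‖X1 t s (z s)‖ := by
      simpa using norm_add_le (J t s - X1 t s (z s)) (X1 t s (z s))
    have a6 : 0 ≤ c₀ * T ^ η * K1 * Kz0 * (t - s) ^ κ := by positivity
    have a7 : 0 ≤ K1 * Kz * (t - s) ^ κ := by positivity
    linarith
  obtain ⟨Kz0, hKz0⟩ := isCompact_Icc.exists_bound_of_continuousOn hz
  have hKz00 : 0 ≤ Kz0 := (norm_nonneg _).trans (hKz0 0 ⟨le_rfl, hT.le⟩)
  refine ⟨J, ⟨J_cont hS hκ (by positivity) hJ (hbd K1 Kz0 Kz hK1 hKz00 hKz hXK hKz0 hzK), hJ,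
    _, hKK, hJK⟩, ?_, hbd, ?_⟩
  · rintro J' ⟨_, hJ', K', hK', hJK'⟩ t s hs hst htT
    exact J_unique (X := fun t s => X1 t s (z s)) hS hM hκη hKK hK' hJ hJK hJ' hJK' hs hst htT
  · intro t s hs hst htT ε hε
    exact riemann_limit (X := fun t s => X1 t s (z s)) hS hM hκη hKK hJ hJK hs htT ε hε
end
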